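/- arXiv:1612.02025 — 6 statements merged into one kernel-verified Lean document; each statement's English description precedes it below -/
import Mathlib

section
/- Let (M,d) be a separable metric space and 1 < λ ≤ 2. Suppose that for every closed ball B of M there exists a good-λ-embedding from B (with the induced metric) into c₀. Then there exists a map from M into c₀ that is simultaneously a strict-λ-embedding and a good-λ-embedding. -/
open Metric Set ZeroAtInfty

/-- The gap of a set `E ⊆ M × M`: `inf {d(x,y) : (x,y) ∈ E}`. -/
noncomputable def pairGap {M : Type*} [MetricSpace M] (E : Set (M × M)) : ℝ :=
  sInf ((fun p : M × M => dist p.1 p.2) '' E)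

/-- The diameter of a set `E ⊆ M × M`: `sup {d(x,y) : (x,y) ∈ E}`. -/
noncomputable def pairDiam {M : Type*} [MetricSpace M] (E : Set (M × M)) : ℝ :=
  sSup ((fun p : M × M => dist p.1 p.2) '' E)

/-- `π(E) = π₁(E) × π₂(E)`, the smallest rectangle containing `E`. -/
def pairRect {M : Type*} (E : Set (M × M)) : Set (M × M) :=
  (Prod.fst '' E) ×ˢ (Prod.snd '' E)

/-- `Es` is a finite partition of `E` into nonempty pairwise disjoint pieces. -/
def IsPartition {α : Type*} {N : ℕ} (Es : Fin N → Set α) (E : Set α) : Prop :=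
  (∀ n, (Es n).Nonempty) ∧ (⋃ n, Es n) = E ∧
    ∀ i j : Fin N, i ≠ j → Disjoint (Es i) (Es j)

/-- Property `π(λ)`. -/
def PropertyPi (M : Type*) [MetricSpace M] (lam : ℝ) : Prop :=
  ∀ (a₁ a₂ : M) (r₁ r₂ : ℝ) (E : Set (M × M)),
    E.Nonempty → E ⊆ (closedBall a₁ r₁) ×ˢ (closedBall a₂ r₂) →
    lam * (r₁ + r₂) < pairGap E →
    ∃ (N : ℕ) (Es : Fin N → Set (M × M)), IsPartition Es E ∧
      ∀ n, pairDiam (Es n) < lam * pairGap (pairRect (Es n))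

/-- A good-λ-embedding into `c₀`. -/
def GoodEmbedding {M : Type*} [MetricSpace M] (lam : ℝ) (f : M → C₀(ℕ, ℝ)) : Prop :=
  (∀ n : ℕ, ∃ K : ℝ, K < lam ∧ ∀ x y : M, |f x n - f y n| ≤ K * dist x y) ∧
    ∀ x y : M, dist x y ≤ ‖f x - f y‖

/-- A strict-λ-embedding into `c₀`. -/
def StrictEmbedding {M : Type*} [MetricSpace M] (lam : ℝ) (f : M → C₀(ℕ, ℝ)) : Prop :=
  ∀ x y : M, x ≠ y → dist x y < ‖f x - f y‖ ∧ ‖f x - f y‖ < lam * dist x y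

/-- A λ-embedding into `c₀`. -/
def LambdaEmbedding {M : Type*} [MetricSpace M] (lam : ℝ) (f : M → C₀(ℕ, ℝ)) : Prop :=
  ∀ x y : M, dist x y ≤ ‖f x - f y‖ ∧ ‖f x - f y‖ ≤ lam * dist x y

/-- The gap between two subsets of `M`: `δ(U,V) = inf {d(u,v) : u ∈ U, v ∈ V}`. -/
noncomputable def setGap {M : Type*} [MetricSpace M] (U V : Set M) : ℝ :=
  sInf ((fun p : M × M => dist p.1 p.2) '' (U ×ˢ V))

lemma exists_norm_eq_abs_apply (g : C₀(ℕ, ℝ)) : ∃ n, ‖g‖ = |g n| := by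
  have key : ∃ n, ∀ m, |g m| ≤ |g n| := by
    by_cases h0 : ∀ m, g m = 0
    · exact ⟨0, fun m => by simp [h0]⟩
    · push Not at h0
      obtain ⟨m, hm⟩ := h0
      have hc : Continuous fun n : ℕ => |g n| := continuous_of_discreteTopology
      refine hc.exists_forall_ge' m ?_
      have ht : Filter.Tendsto (fun n : ℕ => |g n|) (Filter.cocompact ℕ) (nhds 0) := by
        simpa using (zero_at_infty g).abs
      exact (ht.eventually (gt_mem_nhds (abs_pos.mpr hm))).mono fun _ h => h.le
  obtain ⟨n, hn⟩ := key
  refine ⟨n, le_antisymm ?_ ?_⟩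
  · rw [← ZeroAtInftyContinuousMap.norm_toBCF_eq_norm]
    exact (BoundedContinuousFunction.norm_le (abs_nonneg _)).mpr fun m => hn m
  · rw [← ZeroAtInftyContinuousMap.norm_toBCF_eq_norm]
    exact g.toBCF.norm_coe_le_norm n

lemma abs_apply_le_norm (g : C₀(ℕ, ℝ)) (n : ℕ) : |g n| ≤ ‖g‖ := by
  rw [← ZeroAtInftyContinuousMap.norm_toBCF_eq_norm]
  exact g.toBCF.norm_coe_le_norm n

lemma exists_forall_lt_abs_apply_lt (g : C₀(ℕ, ℝ)) {c : ℝ} (hc : 0 < c) :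
    ∃ N : ℕ, ∀ n, N ≤ n → |g n| < c := by
  have ht : Filter.Tendsto (fun n : ℕ => |g n|) Filter.atTop (nhds 0) := by
    have := (zero_at_infty g).abs
    rwa [abs_zero, Filter.cocompact_eq_cofinite, Nat.cofinite_eq_atTop] at this
  exact Filter.eventually_atTop.mp (ht.eventually (gt_mem_nhds hc))

lemma exists_uniform_lt (k : ℕ → ℝ) {c K₀ : ℝ} (hk : ∀ n, k n < c) (hK₀ : K₀ < c) (N : ℕ) :
    ∃ K, K < c ∧ K₀ ≤ K ∧ ∀ n < N, k n ≤ K := by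
  induction N with
  | zero => exact ⟨K₀, hK₀, le_rfl, by simp⟩
  | succ N ih =>
    obtain ⟨K, h1, h2, h3⟩ := ih
    refine ⟨max K (k N), max_lt h1 (hk N), h2.trans (le_max_left _ _), fun n hn => ?_⟩
    rcases Nat.lt_succ_iff_lt_or_eq.mp hn with h | rfl
    · exact (h3 n h).trans (le_max_left _ _)
    · exact le_max_right _ _

/-- McShane extension from a subset, for a function on the subtype. -/
lemma exists_extension_of_lipschitz {M : Type*} [MetricSpace M] (B : Set M) (u : B → ℝ) {K : ℝ}
    (hK : 0 ≤ K) (hu : ∀ x y : B, |u x - u y| ≤ K * dist x y) :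
    ∃ v : M → ℝ, (∀ x y, |v x - v y| ≤ K * dist x y) ∧ ∀ x : B, v x = u x := by
  classical
  lift K to NNReal using hK
  have hl : LipschitzOnWith K (fun x : M => if hx : x ∈ B then u ⟨x, hx⟩ else 0) B := by
    refine LipschitzOnWith.of_dist_le_mul fun x hx y hy => ?_
    simpa [hx, hy, Real.dist_eq, Subtype.dist_eq] using hu ⟨x, hx⟩ ⟨y, hy⟩
  obtain ⟨v, hv, hvu⟩ := hl.extend_real
  refine ⟨v, fun x y => by simpa [Real.dist_eq] using hv.dist_le_mul x y, fun x => ?_⟩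
  simpa using (hvu x.2).symm

lemma exists_finite_coordinates {M : Type*} [MetricSpace M] {lam : ℝ} (hlam : 1 < lam)
    {B : Set M} {f : B → C₀(ℕ, ℝ)} (hf : GoodEmbedding lam f) {G : Set M} (hG : G.Finite)
    (hGne : G.Nonempty) (hGB : G ⊆ B) {η K₀ : ℝ} (hη : 0 < η) (hK₀ : K₀ < lam) :
    ∃ (N : ℕ) (K : ℝ) (v : ℕ → M → ℝ), 1 ≤ K ∧ K₀ ≤ K ∧ K < lam ∧
      (∀ n < N, ∀ x y, |v n x - v n y| ≤ K * dist x y) ∧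
      ∀ x ∈ B, ∀ y ∈ B, lam * (infDist x G + infDist y G) + η ≤ dist x y →
        ∃ n < N, dist x y ≤ |v n x - v n y| := by
  obtain ⟨hL, hlow⟩ := hf
  choose k hk hkL using hL
  have hN : ∀ p : G × G, ∃ N : ℕ, ∀ n, N ≤ n →
      |(f ⟨p.1, hGB p.1.2⟩ - f ⟨p.2, hGB p.2.2⟩) n| < η :=
    fun p => exists_forall_lt_abs_apply_lt _ hη
  choose Nf hNf using hN
  have := hG.to_subtype
  obtain ⟨N, hNle⟩ := (Set.finite_range Nf).bddAbove
  obtain ⟨K, hKlam, hK0, hKk⟩ := exists_uniform_lt k hk (max_lt hlam hK₀) N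
  have hK1 : 1 ≤ K := (le_max_left _ _).trans hK0
  have hext : ∀ n, ∃ v : M → ℝ, n < N →
      (∀ x y, |v x - v y| ≤ K * dist x y) ∧ ∀ x : B, v x = f x n := by
    intro n
    by_cases hn : n < N
    · obtain ⟨v, hv⟩ := exists_extension_of_lipschitz B (fun x => f x n) (K := K) (by linarith)
        fun x y => (hkL n x y).trans (by gcongr; exact hKk n hn)
      exact ⟨v, fun _ => hv⟩
    · exact ⟨0, fun h => absurd h hn⟩
  choose v hv using hext
  refine ⟨N, K, v, hK1, (le_max_right _ _).trans hK0, hKlam, fun n hn => (hv n hn).1,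
    fun x hx y hy hxy => ?_⟩
  obtain ⟨n, hn⟩ := exists_norm_eq_abs_apply (f ⟨x, hx⟩ - f ⟨y, hy⟩)
  have hd : dist x y ≤ |f ⟨x, hx⟩ n - f ⟨y, hy⟩ n| := by
    have := hlow ⟨x, hx⟩ ⟨y, hy⟩
    rw [hn] at this
    simpa [Subtype.dist_eq] using this
  have hnN : n < N := by
    by_contra hcon
    push Not at hcon
    obtain ⟨p, hp, hpx⟩ := hG.isCompact.exists_infDist_eq_dist hGne x
    obtain ⟨q, hq, hqy⟩ := hG.isCompact.exists_infDist_eq_dist hGne y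
    have h1 : |f ⟨p, hGB hp⟩ n - f ⟨q, hGB hq⟩ n| < η := by
      simpa using hNf (⟨p, hp⟩, ⟨q, hq⟩) n ((hNle ⟨_, rfl⟩).trans hcon)
    have h2 : |f ⟨x, hx⟩ n - f ⟨p, hGB hp⟩ n| ≤ lam * dist x p :=
      (hkL n ⟨x, hx⟩ ⟨p, hGB hp⟩).trans (mul_le_mul_of_nonneg_right (hk n).le dist_nonneg)
    have h3 : |f ⟨y, hy⟩ n - f ⟨q, hGB hq⟩ n| ≤ lam * dist y q :=
      (hkL n ⟨y, hy⟩ ⟨q, hGB hq⟩).trans (mul_le_mul_of_nonneg_right (hk n).le dist_nonneg)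
    rw [hpx, hqy] at hxy
    have h4 := abs_le.mp h2
    have h5 := abs_le.mp h3
    have h6 := abs_lt.mp h1
    have : |f ⟨x, hx⟩ n - f ⟨y, hy⟩ n| < lam * (dist x p + dist y q) + η := by
      rw [abs_lt]
      constructor <;> linarith [h4.1, h4.2, h5.1, h5.2, h6.1, h6.2]
    linarith
  exact ⟨n, hnN, by
    rw [(hv n hnN).2 ⟨x, hx⟩, (hv n hnN).2 ⟨y, hy⟩]; exact hd⟩

/-- Clipping of `s` to the interval `[-A, A]`. -/
noncomputable def clip (A s : ℝ) : ℝ := max (-A) (min A s)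

lemma abs_clip_sub_clip_le (A A' s s' e : ℝ) (hA : |A - A'| ≤ e) (hs : |s - s'| ≤ e) :
    |clip A s - clip A' s'| ≤ e := by
  refine (abs_max_sub_max_le_max _ _ _ _).trans (max_le ?_ ?_)
  · rwa [neg_sub_neg, abs_sub_comm]
  · exact (abs_min_sub_min_le_max _ _ _ _).trans (max_le hA hs)

lemma abs_clip_le {A : ℝ} (hA : 0 ≤ A) (s : ℝ) : |clip A s| ≤ A :=
  abs_le.mpr ⟨le_max_left _ _, max_le (by linarith) (min_le_left _ _)⟩

lemma exists_le_clip_sub_clip {A B u v d : ℝ} (hA : 0 ≤ A) (hB : 0 ≤ B) (hd : 0 ≤ d)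
    (hAB : d ≤ A + B) (huv : d ≤ u - v) :
    ∃ c, v ≤ c ∧ c ≤ u ∧ d ≤ clip A (u - c) - clip B (v - c) := by
  refine ⟨max v (u - A), le_max_left _ _, max_le (by linarith) (by linarith), ?_⟩
  unfold clip
  rcases le_total v (u - A) with h | h
  · rw [max_eq_right h]
    simp only [sub_sub_cancel, min_self]
    rw [max_eq_right (by linarith : -A ≤ A), min_eq_right (by linarith : v - (u - A) ≤ B)]
    rcases le_total (-B) (v - (u - A)) with h' | h'
    · rw [max_eq_right h']; linarith
    · rw [max_eq_left h']; linarith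
  · rw [max_eq_left h, sub_self, min_eq_right hB, max_eq_right (by linarith : -B ≤ 0),
      min_eq_right (by linarith : u - v ≤ A), max_eq_right (by linarith : -A ≤ u - v)]
    linarith

lemma exists_grid (R : ℝ) {δ : ℝ} (hδ : 0 < δ) :
    ∃ S : Set ℝ, S.Finite ∧ ∀ c, |c| ≤ R → ∃ s ∈ S, |c - s| ≤ δ := by
  obtain ⟨t, -, ht, hc⟩ := finite_cover_balls_of_compact (isCompact_closedBall (0 : ℝ) R) hδ
  refine ⟨t, ht, fun c hcR => ?_⟩
  have : c ∈ closedBall (0 : ℝ) R := by simpa [Real.dist_eq] using hcR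
  obtain ⟨s, hs, hcs⟩ := mem_iUnion₂.mp (hc this)
  exact ⟨s, hs, by simpa [Real.dist_eq] using (mem_ball.mp hcs).le⟩

lemma exists_stage_set {M : Type*} [MetricSpace M] {lam : ℝ} (hlam : 1 < lam)
    (h : ∀ (a : M) (r : ℝ), ∃ f : (closedBall a r) → C₀(ℕ, ℝ), GoodEmbedding lam f)
    {F G : Set M} {a : M} (haF : a ∈ F) (haG : a ∈ G) (hG : G.Finite)
    {η η' : ℝ} (hη : 0 < η) (hη' : 0 < η') :
    ∃ S : Set (M → ℝ), S.Finite ∧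
      (∀ g ∈ S, (∃ K < lam, ∀ x y, |g x - g y| ≤ K * dist x y) ∧
        ∀ p ∈ F, |g p| ≤ lam * η') ∧
      ∀ x y, lam * (infDist x G + infDist y G) + η ≤ dist x y →
        dist x y < lam * (infDist x F + infDist y F) + η' →
        ∃ g ∈ S, dist x y < |g x - g y| := by
  obtain ⟨D, hD⟩ := (Metric.isBounded_iff_subset_closedBall a).mp hG.isBounded
  have hD0 : 0 ≤ D := by simpa using hD haG
  set R : ℝ := 2 * D / (lam - 1) + D with hR
  have hlam' : 0 < lam - 1 := by linarith
  have hq0 : 0 ≤ 2 * D / (lam - 1) := by positivity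
  have hR0 : 0 ≤ R := by positivity
  have hbound : ∀ x y, lam * (infDist x G + infDist y G) + η ≤ dist x y → dist x a ≤ R := by
    intro x y hxy
    obtain ⟨p, hp, hpx⟩ := hG.isCompact.exists_infDist_eq_dist ⟨a, haG⟩ x
    obtain ⟨q, hq, hqy⟩ := hG.isCompact.exists_infDist_eq_dist ⟨a, haG⟩ y
    rw [hpx, hqy] at hxy
    have hpD : dist p a ≤ D := hD hp
    have hqD : dist q a ≤ D := hD hq
    have h1 : dist x y ≤ dist x p + (dist p a + dist q a) + dist y q := by
      have e1 := dist_triangle4 x p q y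
      have e2 := dist_triangle_right p q a
      rw [dist_comm q y] at e1
      linarith
    have h2 : dist x p ≤ 2 * D / (lam - 1) := by
      rw [le_div_iff₀ hlam']
      nlinarith [dist_nonneg (x := x) (y := p), dist_nonneg (x := y) (y := q)]
    linarith [dist_triangle x p a]
  obtain ⟨f, hf⟩ := h a R
  have hK₀ : lam - η' / (2 * R + 1) < lam := by
    have : 0 < η' / (2 * R + 1) := by positivity
    linarith
  obtain ⟨N, K, v, hK1, hKK, hKlam, hvL, hv⟩ := exists_finite_coordinates hlam hf hG ⟨a, haG⟩
    (hD.trans (closedBall_subset_closedBall (by linarith))) hη hK₀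
  have hKη : (lam - K) * (2 * R) ≤ η' := by
    have h1 : lam - K ≤ η' / (2 * R + 1) := by linarith
    rw [le_div_iff₀ (by positivity)] at h1
    nlinarith
  obtain ⟨κ, hκ1, hκ⟩ : ∃ κ, 1 < κ ∧ κ * K < lam := by
    obtain ⟨κ, h1, h2⟩ := exists_between ((one_lt_div (by linarith)).mpr hKlam)
    exact ⟨κ, h1, (lt_div_iff₀ (by linarith)).mp h2⟩
  have hκlam : κ ≤ lam := by nlinarith
  obtain ⟨δ, hδ, hδη⟩ : ∃ δ, 0 < δ ∧ 2 * κ * δ < (κ - 1) * η := by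
    refine ⟨(κ - 1) * η / (4 * κ), ?_, ?_⟩
    · have : 0 < κ - 1 := by linarith
      positivity
    · have h1 : 0 < (κ - 1) * η := mul_pos (by linarith) hη
      have : 2 * κ * ((κ - 1) * η / (4 * κ)) = (κ - 1) * η / 2 := by
        field_simp
        ring
      linarith
  choose T hTfin hT using fun n : ℕ => exists_grid (|v n a| + K * R) hδ
  set g : ℕ → ℝ → M → ℝ := fun n c z => κ * clip (K * infDist z F + η') (v n z - c) with hg
  have hband : ∀ z, 0 ≤ K * infDist z F + η' := fun z => by
    have := infDist_nonneg (x := z) (s := F)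
    positivity
  refine ⟨⋃ n ∈ Set.Iio N, (g n) '' (T n), (Set.finite_Iio N).biUnion
    fun n _ => (hTfin n).image _, ?_, ?_⟩
  · intro g' hg'
    simp only [mem_iUnion, mem_image, mem_Iio] at hg'
    obtain ⟨n, hn, c, -, rfl⟩ := hg'
    refine ⟨⟨κ * K, hκ, fun x y => ?_⟩, fun p hp => ?_⟩
    · simp only [hg]
      rw [← mul_sub, abs_mul, abs_of_pos (by linarith : 0 < κ), mul_assoc]
      refine mul_le_mul_of_nonneg_left ?_ (by linarith)
      refine abs_clip_sub_clip_le _ _ _ _ _ ?_ ?_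
      · rw [add_sub_add_right_eq_sub, ← mul_sub, abs_mul, abs_of_pos (by linarith : 0 < K)]
        refine mul_le_mul_of_nonneg_left ?_ (by linarith)
        have e1 := infDist_le_infDist_add_dist (s := F) (x := x) (y := y)
        have e2 := infDist_le_infDist_add_dist (s := F) (x := y) (y := x)
        rw [dist_comm y x] at e2
        exact abs_le.mpr ⟨by linarith, by linarith⟩
      · rw [sub_sub_sub_cancel_right]
        exact hvL n hn x y
    · simp only [hg]
      rw [abs_mul, abs_of_pos (by linarith : 0 < κ)]
      have := abs_clip_le (hband p) (v n p - c)
      rw [infDist_zero_of_mem hp] at this ⊢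
      simp only [mul_zero, zero_add] at this ⊢
      exact mul_le_mul hκlam this (abs_nonneg _) (by linarith)
  · have main : ∀ x y, ∀ n < N, lam * (infDist x G + infDist y G) + η ≤ dist x y →
        dist x y < lam * (infDist x F + infDist y F) + η' → dist x y ≤ v n x - v n y →
        ∃ c ∈ T n, dist x y < g n c x - g n c y := by
      intro x y n hn hxy hxy' hle
      have hxR := hbound x y hxy
      have hyR := hbound y x (by rwa [add_comm (infDist y G), dist_comm y x])
      have hxF : infDist x F ≤ R := (infDist_le_dist_of_mem haF).trans hxR
      have hyF : infDist y F ≤ R := (infDist_le_dist_of_mem haF).trans hyR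
      have hsum : dist x y ≤ (K * infDist x F + η') + (K * infDist y F + η') := by
        have : (lam - K) * (infDist x F + infDist y F) ≤ (lam - K) * (2 * R) :=
          mul_le_mul_of_nonneg_left (by linarith) (by linarith)
        nlinarith
      obtain ⟨c, hc1, hc2, hc⟩ :=
        exists_le_clip_sub_clip (hband x) (hband y) dist_nonneg hsum hle
      have hva : ∀ z, dist z a ≤ R → |v n z| ≤ |v n a| + K * R := fun z hz => by
        have e1 := hvL n hn z a
        have e2 : K * dist z a ≤ K * R := mul_le_mul_of_nonneg_left hz (by linarith)
        have e3 := abs_sub_abs_le_abs_sub (v n z) (v n a)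
        linarith
      have hcR : |c| ≤ |v n a| + K * R :=
        abs_le.mpr ⟨(abs_le.mp (hva y hyR)).1.trans hc1, hc2.trans (abs_le.mp (hva x hxR)).2⟩
      obtain ⟨s, hs, hcs⟩ := hT n c hcR
      refine ⟨s, hs, ?_⟩
      have hshift : ∀ z, |clip (K * infDist z F + η') (v n z - s)
          - clip (K * infDist z F + η') (v n z - c)| ≤ δ := fun z =>
        abs_clip_sub_clip_le _ _ _ _ _ (by simpa using hδ.le)
          (by rwa [sub_sub_sub_cancel_left])
      have e1 := (abs_le.mp (hshift x)).1
      have e2 := (abs_le.mp (hshift y)).2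
      have hηd : η ≤ dist x y := by
        have : 0 ≤ lam * (infDist x G + infDist y G) :=
          mul_nonneg (by linarith) (add_nonneg infDist_nonneg infDist_nonneg)
        linarith
      simp only [hg]
      rw [← mul_sub]
      calc dist x y < κ * (dist x y - 2 * δ) := by nlinarith
        _ ≤ _ := mul_le_mul_of_nonneg_left (by linarith) (by linarith)
    intro x y hxy hxy'
    obtain ⟨n, hn, hle⟩ := hv x (hbound x y hxy) y
      (hbound y x (by rwa [add_comm (infDist y G), dist_comm y x])) hxy
    rcases le_abs.mp hle with hle | hle
    · obtain ⟨c, hc, hlt⟩ := main x y n hn hxy hxy' hle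
      exact ⟨g n c, mem_iUnion₂.mpr ⟨n, hn, c, hc, rfl⟩, hlt.trans_le (le_abs_self _)⟩
    · obtain ⟨c, hc, hlt⟩ := main y x n hn
        (by rwa [add_comm (infDist y G), dist_comm y x])
        (by rwa [add_comm (infDist y F), dist_comm y x])
        (by rw [dist_comm y x]; linarith)
      refine ⟨g n c, mem_iUnion₂.mpr ⟨n, hn, c, hc, rfl⟩, ?_⟩
      rw [dist_comm x y, abs_sub_comm]
      exact hlt.trans_le (le_abs_self _)

/-- A finite set of functions, listed as a sequence that is eventually zero. -/
lemma exists_seq_of_finite {M : Type*} {S : Set (M → ℝ)} (hS : S.Finite) :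
    ∃ (m : ℕ) (g : ℕ → M → ℝ), (∀ i, g i ∈ S ∨ g i = 0) ∧ (∀ i, m ≤ i → g i = 0) ∧
      ∀ s ∈ S, ∃ i, g i = s := by
  refine ⟨hS.toFinset.toList.length, fun i => hS.toFinset.toList.getD i 0, fun i => ?_,
    fun i hi => List.getD_eq_default _ _ hi, fun s hs => ?_⟩
  · rcases lt_or_ge i hS.toFinset.toList.length with hi | hi
    · left
      simp only [List.getD_eq_getElem _ _ hi]
      exact hS.mem_toFinset.mp (Finset.mem_toList.mp (List.getElem_mem hi))
    · exact Or.inr (List.getD_eq_default _ _ hi)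
  · have : s ∈ hS.toFinset.toList := by simpa using hs
    obtain ⟨i, hi, rfl⟩ := List.getElem_of_mem this
    exact ⟨i, List.getD_eq_getElem _ _ hi⟩

lemma exists_stage_seq {M : Type*} [MetricSpace M] {lam : ℝ} (hlam : 1 < lam)
    (h : ∀ (a : M) (r : ℝ), ∃ f : (closedBall a r) → C₀(ℕ, ℝ), GoodEmbedding lam f)
    {F G : Set M} {a : M} (haF : a ∈ F) (haG : a ∈ G) (hG : G.Finite)
    {η η' : ℝ} (hη : 0 < η) (hη' : 0 < η') :
    ∃ (m : ℕ) (g : ℕ → M → ℝ), (∀ i, m ≤ i → g i = 0) ∧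
      (∀ i, ∃ K < lam, ∀ x y, |g i x - g i y| ≤ K * dist x y) ∧
      (∀ i, ∀ p ∈ F, |g i p| ≤ lam * η') ∧
      ∀ x y, lam * (infDist x G + infDist y G) + η ≤ dist x y →
        dist x y < lam * (infDist x F + infDist y F) + η' →
        ∃ i, dist x y < |g i x - g i y| := by
  obtain ⟨S, hS, hSL, hSd⟩ := exists_stage_set hlam h haF haG hG hη hη'
  obtain ⟨m, g, hgS, hgm, hSg⟩ := exists_seq_of_finite hS
  refine ⟨m, g, hgm, fun i => ?_, fun i p hp => ?_, fun x y hxy hxy' => ?_⟩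
  · rcases hgS i with hi | hi
    · exact (hSL _ hi).1
    · exact ⟨0, by linarith, by simp [hi]⟩
  · rcases hgS i with hi | hi
    · exact (hSL _ hi).2 p hp
    · have : 0 ≤ lam * η' := mul_nonneg (by linarith) hη'.le
      simpa [hi] using this
  · obtain ⟨s, hs, hlt⟩ := hSd x y hxy hxy'
    obtain ⟨i, rfl⟩ := hSg s hs
    exact ⟨i, hlt⟩

/-- If `M` is separable, `1 < λ ≤ 2`, and every closed ball of `M` admits a good-λ-embedding
into `c₀`, then `M` admits a map into `c₀` which is both a strict and a good λ-embedding. -/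
theorem stmt13 {M : Type*} [MetricSpace M] [TopologicalSpace.SeparableSpace M]
    (lam : ℝ) (hlam₁ : 1 < lam) (hlam₂ : lam ≤ 2)
    (h : ∀ (a : M) (r : ℝ), ∃ f : (closedBall a r) → C₀(ℕ, ℝ), GoodEmbedding lam f) :
    ∃ f : M → C₀(ℕ, ℝ), StrictEmbedding lam f ∧ GoodEmbedding lam f := by
  rcases isEmpty_or_nonempty M with hM | hM
  · exact ⟨fun _ => 0, fun x => isEmptyElim x,
      fun _ => ⟨0, by linarith, fun x => isEmptyElim x⟩, fun x => isEmptyElim x⟩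
  set q := TopologicalSpace.denseSeq M
  set F : ℕ → Set M := fun k => q '' Set.Iic k with hF
  set η : ℕ → ℝ := fun k => 1 / ((k : ℝ) + 1) with hη
  have hηpos : ∀ k, 0 < η k := fun k => by simp only [hη]; positivity
  have hηlim : Filter.Tendsto η Filter.atTop (nhds 0) := tendsto_one_div_add_atTop_nhds_zero_nat
  have hmem : ∀ {i k}, i ≤ k → q i ∈ F k := fun hik => ⟨_, hik, rfl⟩
  have happrox : ∀ x : M, ∀ ε > 0, ∃ i, dist x (q i) < ε := fun x ε hε => by
    obtain ⟨_, hi, ⟨i, rfl⟩⟩ :=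
      Metric.dense_iff.mp (TopologicalSpace.denseRange_denseSeq M) x ε hε
    exact ⟨i, by rw [dist_comm]; exact hi⟩
  choose m g hgm hgL hgF hgd using fun k => exists_stage_seq hlam₁ h
    (hmem (Nat.zero_le k)) (hmem (Nat.zero_le (k + 1))) ((Set.finite_Iic (k + 1)).image q)
    (hηpos (k + 1)) (hηpos k)
  have hlim : ∀ x, Filter.Tendsto (fun n : ℕ => g n.unpair.1 n.unpair.2 x)
      (Filter.cocompact ℕ) (nhds 0) := by
    intro x
    rw [Filter.cocompact_eq_cofinite, Metric.tendsto_nhds]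
    intro ε hε
    obtain ⟨i, hi⟩ := happrox x (ε / (2 * lam)) (by positivity)
    obtain ⟨k₁, hk₁⟩ := Filter.eventually_atTop.mp
      (hηlim.eventually (gt_mem_nhds (by positivity : 0 < ε / (2 * lam))))
    rw [lt_div_iff₀ (by positivity)] at hi
    rw [Filter.eventually_cofinite]
    refine Set.Finite.subset (s := ⋃ k ∈ Set.Iio (max i k₁), Nat.pair k '' Set.Iio (m k))
      ((Set.finite_Iio _).biUnion fun k _ => (Set.finite_Iio _).image _) fun n hn => ?_
    have hn' : ε ≤ |g n.unpair.1 n.unpair.2 x| := by simpa [Real.dist_eq] using hn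
    refine mem_iUnion₂.mpr ⟨n.unpair.1, ?_, n.unpair.2, ?_, Nat.pair_unpair n⟩
    · by_contra hcon
      rw [mem_Iio, not_lt, max_le_iff] at hcon
      have e1 := hgF n.unpair.1 n.unpair.2 (q i) (hmem hcon.1)
      obtain ⟨K, hK, hKL⟩ := hgL n.unpair.1 n.unpair.2
      have e2 := (hKL x (q i)).trans (mul_le_mul_of_nonneg_right hK.le dist_nonneg)
      have e3 := hk₁ _ hcon.2
      rw [lt_div_iff₀ (by positivity)] at e3
      have e4 := abs_sub_abs_le_abs_sub (g n.unpair.1 n.unpair.2 x) (g n.unpair.1 n.unpair.2 (q i))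
      linarith
    · by_contra hcon
      rw [mem_Iio, not_lt] at hcon
      rw [hgm _ _ hcon] at hn'
      simp at hn'
      linarith
  set f : M → C₀(ℕ, ℝ) := fun x =>
    ⟨⟨fun n => g n.unpair.1 n.unpair.2 x, continuous_of_discreteTopology⟩, hlim x⟩ with hf
  have hfapp : ∀ x n, f x n = g n.unpair.1 n.unpair.2 x := fun _ _ => rfl
  have hlow : ∀ x y : M, x ≠ y → dist x y < ‖f x - f y‖ := by
    intro x y hxy
    have hd : 0 < dist x y := dist_pos.mpr hxy
    have hex : ∃ k, lam * (infDist x (F k) + infDist y (F k)) + η k ≤ dist x y := by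
      obtain ⟨i, hi⟩ := happrox x (dist x y / (4 * lam)) (by positivity)
      obtain ⟨j, hj⟩ := happrox y (dist x y / (4 * lam)) (by positivity)
      obtain ⟨k₁, hk₁⟩ := Filter.eventually_atTop.mp
        (hηlim.eventually (gt_mem_nhds (by positivity : 0 < dist x y / 2)))
      rw [lt_div_iff₀ (by positivity)] at hi hj
      refine ⟨max (max i j) k₁, ?_⟩
      have e1 := hk₁ _ (le_max_right (max i j) k₁)
      have e2 : infDist x (F (max (max i j) k₁)) ≤ dist x (q i) :=
        infDist_le_dist_of_mem (hmem ((le_max_left _ _).trans (le_max_left _ _)))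
      have e3 : infDist y (F (max (max i j) k₁)) ≤ dist y (q j) :=
        infDist_le_dist_of_mem (hmem ((le_max_right _ _).trans (le_max_left _ _)))
      have e4 := mul_le_mul_of_nonneg_left (add_le_add e2 e3) (by linarith : 0 ≤ lam)
      linarith
    classical
    have hspec := Nat.find_spec hex
    have hmin := fun j => Nat.find_min hex (m := j)
    set k := Nat.find hex
    rcases k with _ | k
    · have hF0 : F 0 = {q 0} := by
        simp [hF, Set.Iic]
      rw [hF0, infDist_singleton, infDist_singleton] at hspec
      have e1 := dist_triangle_right x y (q 0)
      have e2 : 0 ≤ (lam - 1) * (dist x (q 0) + dist y (q 0)) :=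
        mul_nonneg (by linarith) (by positivity)
      linarith [hηpos 0]
    · obtain ⟨i, hi⟩ := hgd k x y hspec (not_le.mp (hmin k (Nat.lt_succ_self k)))
      refine hi.trans_le ?_
      have := abs_apply_le_norm (f x - f y) (Nat.pair k i)
      simpa [hfapp] using this
  have hcoord : ∀ n : ℕ, ∃ K : ℝ, K < lam ∧ ∀ x y : M, |f x n - f y n| ≤ K * dist x y :=
    fun n => hgL n.unpair.1 n.unpair.2
  refine ⟨f, fun x y hxy => ⟨hlow x y hxy, ?_⟩, hcoord, fun x y => ?_⟩
  · obtain ⟨n, hn⟩ := exists_norm_eq_abs_apply (f x - f y)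
    obtain ⟨K, hK, hKL⟩ := hcoord n
    rw [hn]
    exact (hKL x y).trans_lt (mul_lt_mul_of_pos_right hK (dist_pos.mpr hxy))
  · rcases eq_or_ne x y with rfl | hxy
    · simp
    · exact (hlow x y hxy).le
end

section
/- Let (M,d) be a metric space and λ > 1. If M has property Π(λ), then M has property π(λ). -/
open Metric Set ZeroAtInfty

/-- The Kalton–Lancien property Π(λ). -/
def PropertyPiKL (M : Type*) [MetricSpace M] (lam : ℝ) : Prop :=
  ∀ μ : ℝ, lam < μ → ∃ ν : ℝ, μ < ν ∧
    ∀ (a₁ a₂ : M) (r₁ r₂ : ℝ), 0 < r₁ → 0 < r₂ →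
      ∃ (N : ℕ) (U V : Fin N → Set M),
        {p : M × M | p ∈ (closedBall a₁ r₁) ×ˢ (closedBall a₂ r₂) ∧
            μ * (r₁ + r₂) < dist p.1 p.2} ⊆ ⋃ n, (U n) ×ˢ (V n) ∧
        ∀ n, ν * (r₁ + r₂) ≤ lam * setGap (U n) (V n)

theorem bddBelow_dist_image {M : Type*} [MetricSpace M] (E : Set (M × M)) :
    BddBelow ((fun p : M × M => dist p.1 p.2) '' E) :=
  ⟨0, by rintro _ ⟨p, -, rfl⟩; exact dist_nonneg⟩

/-- A finite cover of `E` can be refined to a finite partition of `E`. -/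
theorem exists_isPartition_of_finite_cover {α : Type*} {E : Set α} {𝒞 : Set (Set α)}
    (h𝒞 : 𝒞.Finite) (hE : E ⊆ ⋃₀ 𝒞) :
    ∃ (N : ℕ) (Es : Fin N → Set α), IsPartition Es E ∧ ∀ n, ∃ C ∈ 𝒞, Es n ⊆ C := by
  choose f hf𝒞 hf using fun x : E => hE x.2
  have hfin : (range f).Finite := h𝒞.subset (by rintro _ ⟨x, rfl⟩; exact hf𝒞 x)
  have := hfin.to_subtype
  obtain ⟨N, ⟨e⟩⟩ := Finite.exists_equiv_fin (range f)
  refine ⟨N, fun n => {x | ∃ hx : x ∈ E, f ⟨x, hx⟩ = e.symm n}, ⟨fun n => ?_, ?_, ?_⟩, fun n => ?_⟩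
  · obtain ⟨x, hx⟩ := (e.symm n).2
    exact ⟨x, x.2, hx⟩
  · ext x
    simp only [mem_iUnion, mem_ofPred_eq]
    exact ⟨fun ⟨_, hx, _⟩ => hx, fun hx => ⟨e ⟨f ⟨x, hx⟩, mem_range_self _⟩, hx, by simp⟩⟩
  · intro i j hij
    refine Set.disjoint_left.2 ?_
    rintro x ⟨hx, hi⟩ ⟨_, hj⟩
    exact hij (e.symm.injective (Subtype.ext (hi.symm.trans hj)))
  · obtain ⟨x, hx⟩ := (e.symm n).2
    refine ⟨e.symm n, hx ▸ hf𝒞 x, ?_⟩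
    rintro y ⟨hy, hyn⟩
    exact hyn ▸ hf ⟨y, hy⟩

theorem pairDiam_lt_of_subset_prod {M : Type*} [MetricSpace M] {lam b : ℝ} (hlam : 0 ≤ lam)
    {T : Set (M × M)} {U V : Set M} (hT : T.Nonempty) (hTUV : T ⊆ U ×ˢ V)
    (hTb : ∀ p ∈ T, dist p.1 p.2 ≤ b) (hb : b < lam * setGap U V) :
    pairDiam T < lam * pairGap (pairRect T) := by
  have hdiam : pairDiam T ≤ b :=
    csSup_le (hT.image _) (by rintro _ ⟨p, hp, rfl⟩; exact hTb p hp)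
  have hrect : pairRect T ⊆ U ×ˢ V := by
    rintro ⟨x, y⟩ ⟨⟨p, hp, rfl⟩, ⟨q, hq, rfl⟩⟩
    exact ⟨(hTUV hp).1, (hTUV hq).2⟩
  have hne : (pairRect T).Nonempty := (hT.image _).prod (hT.image _)
  have hgap : setGap U V ≤ pairGap (pairRect T) :=
    csInf_le_csInf (bddBelow_dist_image _) (hne.image _) (image_mono hrect)
  exact hdiam.trans_lt (hb.trans_le (mul_le_mul_of_nonneg_left hgap hlam))

theorem exists_gt_mul_lt {a s G : ℝ} (hs : 0 ≤ s) (h : a * s < G) :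
    ∃ μ, a < μ ∧ μ * s < G := by
  rcases hs.eq_or_lt with rfl | hs
  · exact ⟨a + 1, by linarith, by simpa using h⟩
  · obtain ⟨μ, h₁, h₂⟩ := exists_between ((lt_div_iff₀ hs).2 h)
    exact ⟨μ, h₁, (lt_div_iff₀ hs).1 h₂⟩

/-- Rescaling: a value `t > μ * s` lies in `(μ * s', ρ * s')` for a suitable `s' > s`. -/
theorem exists_gt_mul_lt_lt_mul {μ ρ s t : ℝ} (hμ : 0 < μ) (hρ : μ < ρ) (hs : 0 ≤ s)
    (ht : μ * s < t) : ∃ s', s < s' ∧ μ * s' < t ∧ t < ρ * s' := by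
  have ht0 : 0 < t := (mul_nonneg hμ.le hs).trans_lt ht
  have h₁ : s < t / μ := (lt_div_iff₀' hμ).2 ht
  have h₂ : t / ρ < t / μ := div_lt_div_of_pos_left ht0 hμ hρ
  obtain ⟨s', h₃, h₄⟩ := exists_between (max_lt h₁ h₂)
  exact ⟨s', (le_max_left _ _).trans_lt h₃, (lt_div_iff₀' hμ).1 h₄,
    (div_lt_iff₀' (hμ.trans hρ)).1 ((le_max_right _ _).trans_lt h₃)⟩

/-- Lemma 5.4: property Π(λ) implies property π(λ). -/
theorem stmt14 {M : Type*} [MetricSpace M] (lam : ℝ) (hlam : 1 < lam)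
    (h : PropertyPiKL M lam) : PropertyPi M lam := by
  intro a₁ a₂ r₁ r₂ E hE hEB hgap
  obtain ⟨p₀, hp₀⟩ := hE
  have hr₁ : 0 ≤ r₁ := dist_nonneg.trans (mem_closedBall.1 (hEB hp₀).1)
  have hr₂ : 0 ≤ r₂ := dist_nonneg.trans (mem_closedBall.1 (hEB hp₀).2)
  have hs : 0 ≤ r₁ + r₂ := add_nonneg hr₁ hr₂
  obtain ⟨μ, hlamμ, hμ⟩ := exists_gt_mul_lt hs hgap
  obtain ⟨ν, hμν, hν⟩ := h μ hlamμ
  obtain ⟨ρ, hμρ, hρν⟩ := exists_between hμν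
  have hμ0 : 0 < μ := by linarith
  let D := r₁ + dist a₁ a₂ + r₂
  have hcover : ∃ 𝒞 : Set (Set (M × M)), 𝒞.Finite ∧
      {p ∈ E | dist p.1 p.2 ∈ Icc (pairGap E) D} ⊆ ⋃₀ 𝒞 ∧
      ∀ C ∈ 𝒞, ∀ T ⊆ C, T.Nonempty → pairDiam T < lam * pairGap (pairRect T) := by
    refine isCompact_Icc.induction_on (s := Icc (pairGap E) D)
      (p := fun S => ∃ 𝒞 : Set (Set (M × M)), 𝒞.Finite ∧
        {p ∈ E | dist p.1 p.2 ∈ S} ⊆ ⋃₀ 𝒞 ∧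
        ∀ C ∈ 𝒞, ∀ T ⊆ C, T.Nonempty → pairDiam T < lam * pairGap (pairRect T))
      ⟨∅, finite_empty, by simp, by simp⟩ ?_ ?_ ?_
    · rintro S S' hSS' ⟨𝒞, hfin, hcov, hgood⟩
      exact ⟨𝒞, hfin, fun p hp => hcov ⟨hp.1, hSS' hp.2⟩, hgood⟩
    · rintro S S' ⟨𝒞, hfin, hcov, hgood⟩ ⟨𝒞', hfin', hcov', hgood'⟩
      refine ⟨𝒞 ∪ 𝒞', hfin.union hfin', ?_, fun C hC => hC.elim (hgood C) (hgood' C)⟩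
      rw [sUnion_union]
      rintro p ⟨hp, hpS⟩
      exact hpS.imp (fun h => hcov ⟨hp, h⟩) (fun h => hcov' ⟨hp, h⟩)
    · intro t ht
      obtain ⟨s', hss', hμt, htρ⟩ := exists_gt_mul_lt_lt_mul hμ0 hμρ hs (hμ.trans_le ht.1)
      have hs' : 0 < s' := hs.trans_lt hss'
      obtain ⟨N, U, V, hcov, hUV⟩ := hν a₁ a₂ (r₁ + (s' - (r₁ + r₂)) / 2)
        (r₂ + (s' - (r₁ + r₂)) / 2) (by linarith) (by linarith)
      have hsum : r₁ + (s' - (r₁ + r₂)) / 2 + (r₂ + (s' - (r₁ + r₂)) / 2) = s' := by ring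
      rw [hsum] at hcov hUV
      refine ⟨Ioo (μ * s') (ρ * s'), mem_nhdsWithin_of_mem_nhds (Ioo_mem_nhds hμt htρ),
        range fun n => (U n ×ˢ V n) ∩ {p | dist p.1 p.2 < ρ * s'}, finite_range _, ?_, ?_⟩
      · rintro p ⟨hp, hpt⟩
        obtain ⟨n, hn⟩ := mem_iUnion.1 (hcov ⟨⟨closedBall_subset_closedBall (by linarith)
          (hEB hp).1, closedBall_subset_closedBall (by linarith) (hEB hp).2⟩, hpt.1⟩)
        exact ⟨_, mem_range_self n, hn, hpt.2⟩
      · rintro _ ⟨n, rfl⟩ T hT hTne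
        exact pairDiam_lt_of_subset_prod (by linarith) hTne (fun p hp => (hT hp).1)
          (fun p hp => (hT hp).2.le) ((mul_lt_mul_of_pos_right hρν hs').trans_le (hUV n))
  obtain ⟨𝒞, hfin, hcov, hgood⟩ := hcover
  have hE𝒞 : E ⊆ ⋃₀ 𝒞 := by
    refine fun p hp => hcov ⟨hp, csInf_le (bddBelow_dist_image E) (mem_image_of_mem _ hp), ?_⟩
    have h₁ : dist p.1 a₁ ≤ r₁ := (hEB hp).1
    have h₂ : dist a₂ p.2 ≤ r₂ := mem_closedBall'.1 (hEB hp).2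
    exact (dist_triangle4 _ a₁ a₂ _).trans (add_le_add (add_le_add_left h₁ _) h₂)
  obtain ⟨N, Es, hpart, hsub⟩ := exists_isPartition_of_finite_cover hfin hE𝒞
  refine ⟨N, Es, hpart, fun n => ?_⟩
  obtain ⟨C, hC, hnC⟩ := hsub n
  exact hgood C hC _ hnC (hpart.1 n)
end

section
/- Let X be a real Banach space and λ ≥ 1. Suppose there exist u ∈ X with ‖u‖ = 1 and an infinite-dimensional closed subspace Y of X such that inf{‖u + 2y‖ : y ∈ Y, ‖y‖ = 1} > λ. Then there is no λ-embedding from X into c₀⁺. -/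
open Metric Set ZeroAtInfty

namespace Cochain

variable {V : Type*}

/-- The simplicial coboundary of a mod 2 cochain on ordered tuples of points. -/
def coboundary : (List V → ZMod 2) → List V → ZMod 2
  | _, [] => 0
  | φ, x :: l => φ l + coboundary (fun m => φ (x :: m)) l

/-- The prism operator associated with a pair of vertex maps. -/
def prism (f g : V → V) : (List V → ZMod 2) → List V → ZMod 2
  | _, [] => 0
  | φ, x :: l => φ (f x :: g x :: l.map g) + prism f g (fun m => φ (f x :: m)) l

lemma coboundary_add (φ ψ : List V → ZMod 2) (l : List V) :
    coboundary (fun m => φ m + ψ m) l = coboundary φ l + coboundary ψ l := by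
  induction l generalizing φ ψ with
  | nil => simp [coboundary]
  | cons x l ih => simp only [coboundary, ih]; ring

lemma coboundary_const_mul (a : ZMod 2) (φ : List V → ZMod 2) (l : List V) :
    coboundary (fun m => a * φ m) l = a * coboundary φ l := by
  induction l generalizing φ with
  | nil => simp [coboundary]
  | cons x l ih => simp only [coboundary, ih]; ring

lemma coboundary_sum (n : ℕ) (φ : ℕ → List V → ZMod 2) (l : List V) :
    coboundary (fun m => ∑ k ∈ Finset.range n, φ k m) l =
      ∑ k ∈ Finset.range n, coboundary (φ k) l := by
  induction l generalizing φ with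
  | nil => simp [coboundary]
  | cons x l ih => simp only [coboundary, ih, Finset.sum_add_distrib]

lemma coboundary_comp_map (g : V → V) (φ : List V → ZMod 2) (l : List V) :
    coboundary (fun m => φ (m.map g)) l = coboundary φ (l.map g) := by
  induction l generalizing φ with
  | nil => simp [coboundary]
  | cons x l ih =>
    simp only [coboundary, List.map_cons]
    rw [ih (fun m => φ (g x :: m))]

lemma prism_add (f g : V → V) (φ ψ : List V → ZMod 2) (l : List V) :
    prism f g (fun m => φ m + ψ m) l = prism f g φ l + prism f g ψ l := by
  induction l generalizing φ ψ with
  | nil => simp [prism]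
  | cons x l ih => simp only [prism, ih]; ring

lemma prism_coboundary_add_coboundary_prism (f g : V → V) (φ : List V → ZMod 2) (l : List V) :
    prism f g (coboundary φ) l + coboundary (prism f g φ) l = φ (l.map f) + φ (l.map g) := by
  induction l generalizing φ with
  | nil => simp [prism, coboundary, CharTwo.add_self_eq_zero]
  | cons x l ih =>
    have h := ih (fun m => φ (f x :: m))
    simp only [prism, coboundary, List.map_cons, prism_add, coboundary_add]
    rw [coboundary_comp_map g (fun m => φ (f x :: g x :: m))]
    linear_combination h + (φ (f x :: l.map g) +
      coboundary (fun m => φ (f x :: g x :: m)) (l.map g) + prism f g φ l) *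
        CharTwo.two_eq_zero (R := ZMod 2)

lemma prism_congr (f g : V → V) {φ ψ : List V → ZMod 2} {l : List V}
    (h : ∀ m : List V, m.length = l.length + 1 → (∀ z ∈ m, ∃ x ∈ l, z = f x ∨ z = g x) →
      φ m = ψ m) :
    prism f g φ l = prism f g ψ l := by
  induction l generalizing φ ψ with
  | nil => rfl
  | cons x l ih =>
    simp only [prism]
    congr 1
    · refine h _ (by simp) fun z hz => ?_
      simp only [List.mem_cons, List.mem_map] at hz
      rcases hz with rfl | rfl | ⟨y, hy, rfl⟩
      · exact ⟨x, by simp, .inl rfl⟩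
      · exact ⟨x, by simp, .inr rfl⟩
      · exact ⟨y, by simp [hy], .inr rfl⟩
    · refine ih fun m hm hz => h _ (by simp [hm]) fun z hz' => ?_
      rcases List.mem_cons.1 hz' with rfl | hz'
      · exact ⟨x, by simp, .inl rfl⟩
      · obtain ⟨y, hy, h⟩ := hz z hz'
        exact ⟨y, by simp [hy], h⟩

/-- The operator `1 + ν`, where `ν` is the action of the antipodal map on cochains. -/
def addNeg [Neg V] (φ : List V → ZMod 2) (l : List V) : ZMod 2 :=
  φ l + φ (l.map Neg.neg)

/-- The sum of the prism operators along the discrete homotopy `G 0, …, G n`. -/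
def homotopy (G : ℕ → V → V) (n : ℕ) (φ : List V → ZMod 2) (l : List V) : ZMod 2 :=
  ∑ k ∈ Finset.range n, prism (G k) (G (k + 1)) φ l

/-- Evaluation of a cochain on the `i`-dimensional hemisphere built from `p` by successively
contracting the lower-dimensional sphere along the discrete homotopies `G i`. -/
def hemisphere [Neg V] (G : ℕ → ℕ → V → V) (n : ℕ) (p : V) : ℕ → (List V → ZMod 2) → ZMod 2
  | 0, φ => φ [p]
  | i + 1, φ => hemisphere G n p i (addNeg (homotopy (G i) n φ))

lemma homotopy_coboundary (G : ℕ → V → V) (n : ℕ) (φ : List V → ZMod 2) (l : List V) :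
    homotopy G n (coboundary φ) l + coboundary (homotopy G n φ) l =
      φ (l.map (G 0)) + φ (l.map (G n)) := by
  have : coboundary (homotopy G n φ) l =
      ∑ k ∈ Finset.range n, coboundary (prism (G k) (G (k + 1)) φ) l :=
    coboundary_sum n (fun k => prism (G k) (G (k + 1)) φ) l
  rw [this, homotopy, ← Finset.sum_add_distrib]
  simp only [prism_coboundary_add_coboundary_prism]
  induction n with
  | zero => simp [CharTwo.add_self_eq_zero]
  | succ n ih =>
    rw [Finset.sum_range_succ, ih (coboundary_sum n (fun k => prism (G k) (G (k + 1)) φ) l)]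
    linear_combination φ (l.map (G n)) * CharTwo.two_eq_zero (R := ZMod 2)

lemma addNeg_add [Neg V] (φ ψ : List V → ZMod 2) : addNeg (φ + ψ) = addNeg φ + addNeg ψ := by
  ext l
  simp only [addNeg, Pi.add_apply]; ring

lemma homotopy_add (G : ℕ → V → V) (n : ℕ) (φ ψ : List V → ZMod 2) :
    homotopy G n (φ + ψ) = homotopy G n φ + homotopy G n ψ := by
  ext l
  simp only [homotopy, Pi.add_apply, ← Finset.sum_add_distrib]
  exact Finset.sum_congr rfl fun k _ => prism_add _ _ φ ψ l

section Neg

variable [InvolutiveNeg V]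

lemma addNeg_addNeg (φ : List V → ZMod 2) : addNeg (addNeg φ) = 0 := by
  ext l
  have : (l.map Neg.neg).map Neg.neg = l := by simp
  simp only [addNeg, this, Pi.zero_apply]
  linear_combination (φ l + φ (l.map Neg.neg)) * CharTwo.two_eq_zero (R := ZMod 2)

lemma coboundary_addNeg (φ : List V → ZMod 2) : coboundary (addNeg φ) = addNeg (coboundary φ) := by
  ext l
  rw [addNeg, ← coboundary_comp_map, ← coboundary_add]
  rfl

variable (G : ℕ → ℕ → V → V) (n : ℕ) (p : V)

lemma hemisphere_add (i : ℕ) (φ ψ : List V → ZMod 2) :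
    hemisphere G n p i (φ + ψ) = hemisphere G n p i φ + hemisphere G n p i ψ := by
  induction i generalizing φ ψ with
  | zero => rfl
  | succ i ih => simp only [hemisphere, homotopy_add, addNeg_add, ih]

lemma hemisphere_zero (i : ℕ) : hemisphere G n p i 0 = 0 := by
  have := hemisphere_add G n p i 0 0
  simpa using this

/-- The boundary of the hemisphere of dimension `i + 1` is the sum of the two hemispheres of
dimension `i`. -/
lemma hemisphere_coboundary (hG0 : ∀ i x, G i 0 x = x) (hGn : ∀ i x y, G i n x = G i n y)
    (i : ℕ) (φ : List V → ZMod 2) :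
    hemisphere G n p (i + 1) (coboundary φ) = hemisphere G n p i (addNeg φ) := by
  have key : ∀ i (φ : List V → ZMod 2),
      addNeg (homotopy (G i) n (coboundary φ)) =
        addNeg φ + coboundary (addNeg (homotopy (G i) n φ)) := by
    intro i φ
    rw [coboundary_addNeg]
    ext l
    have h1 := homotopy_coboundary (G i) n φ l
    have h2 := homotopy_coboundary (G i) n φ (l.map Neg.neg)
    have h3 : (l.map Neg.neg).map (G i n) = l.map (G i n) := by
      simp only [List.map_map, List.map_inj_left]
      exact fun a _ => hGn _ _ _
    have h0 : ∀ l : List V, l.map (G i 0) = l := fun l => by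
      simp [funext (hG0 i)]
    rw [h0] at h1 h2
    rw [h3] at h2
    simp only [addNeg, Pi.add_apply]
    linear_combination h1 + h2 + (φ (l.map (G i n)) - coboundary (homotopy (G i) n φ) l -
      coboundary (homotopy (G i) n φ) (l.map Neg.neg)) * CharTwo.two_eq_zero (R := ZMod 2)
  have cycle : ∀ i (ψ : List V → ZMod 2), hemisphere G n p i (coboundary (addNeg ψ)) = 0 := by
    intro i
    induction i with
    | zero => intro ψ; simp [hemisphere, coboundary, addNeg, CharTwo.add_self_eq_zero]
    | succ i ih =>
      intro ψ
      rw [hemisphere, key, hemisphere_add, ih, addNeg_addNeg, hemisphere_zero, add_zero]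
  rw [hemisphere, key, hemisphere_add, cycle, add_zero]

end Neg

/-- The cup product of the coboundaries of the `0`-cochains `s k, s (k + 1), …`. -/
def cup (s : ℕ → V → ZMod 2) : ℕ → List V → ZMod 2
  | _, [] => 0
  | _, [_] => 1
  | k, x :: y :: l => (s k x + s k y) * cup s (k + 1) (y :: l)

lemma coboundary_cup (s : ℕ → V → ZMod 2) (k : ℕ) (l : List V) : coboundary (cup s k) l = 0 := by
  match l with
  | [] => rfl
  | [x] => simp [coboundary, cup]
  | [x, y] => simp [coboundary, cup, CharTwo.add_self_eq_zero]
  | x :: y :: z :: l =>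
    have ih := coboundary_cup s (k + 1) (y :: z :: l)
    simp only [coboundary, cup, coboundary_const_mul] at ih ⊢
    linear_combination (s k x + s k y) * ih +
      s k z * cup s (k + 1) (z :: l) * CharTwo.two_eq_zero (R := ZMod 2)

/-- A primitive of `cup s k`. -/
def cupPrimitive (s : ℕ → V → ZMod 2) (k : ℕ) : List V → ZMod 2
  | [] => 1
  | x :: l => s k x * cup s (k + 1) (x :: l)

lemma coboundary_cupPrimitive (s : ℕ → V → ZMod 2) (k : ℕ) :
    coboundary (cupPrimitive s k) = cup s k := by
  ext l
  match l with
  | [] => rfl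
  | [x] => simp [coboundary, cup, cupPrimitive]
  | x :: y :: l =>
    have ih := coboundary_cup s (k + 1) (x :: y :: l)
    simp only [coboundary] at ih
    simp only [coboundary, cupPrimitive, coboundary_const_mul, cup] at ih ⊢
    linear_combination s k x * ih - s k x * cup s (k + 1) (y :: l) *
      CharTwo.two_eq_zero (R := ZMod 2)

lemma cup_map_neg [Neg V] (s : ℕ → V → ZMod 2) (k : ℕ) (l : List V)
    (hs : ∀ k, ∀ x ∈ l, s k (-x) = s k x + 1) : cup s k (l.map Neg.neg) = cup s k l := by
  match l with
  | [] => rfl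
  | [x] => rfl
  | x :: y :: l =>
    have ih := cup_map_neg s (k + 1) (y :: l) fun k z hz => hs k z (List.mem_cons_of_mem _ hz)
    simp only [List.map_cons] at ih
    simp only [List.map_cons, cup, ih]
    rw [hs k x (by simp), hs k y (by simp)]
    linear_combination cup s (k + 1) (y :: l) * CharTwo.two_eq_zero (R := ZMod 2)

lemma addNeg_cupPrimitive [Neg V] (s : ℕ → V → ZMod 2) (k : ℕ) (l : List V) (hl : l ≠ [])
    (hs : ∀ k, ∀ x ∈ l, s k (-x) = s k x + 1) :
    addNeg (cupPrimitive s k) l = cup s (k + 1) l := by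
  match l with
  | [] => exact absurd rfl hl
  | x :: l =>
    have h := cup_map_neg s (k + 1) (x :: l) hs
    simp only [List.map_cons] at h
    simp only [addNeg, List.map_cons, cupPrimitive, h, hs k x (by simp)]
    linear_combination s k x * cup s (k + 1) (x :: l) * CharTwo.two_eq_zero (R := ZMod 2)

lemma exists_ne_of_cup_ne_zero (s : ℕ → V → ZMod 2) (k : ℕ) (l : List V) (h : cup s k l ≠ 0)
    (j : ℕ) (hj : j + 1 < l.length) : ∃ x ∈ l, ∃ y ∈ l, s (k + j) x ≠ s (k + j) y := by
  match l with
  | [] => simp at hj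
  | [x] => simp at hj
  | x :: y :: l =>
    rw [cup] at h
    rcases j with _ | j
    · refine ⟨x, by simp, y, by simp, fun hxy => h ?_⟩
      rw [Nat.add_zero] at hxy
      rw [hxy, CharTwo.add_self_eq_zero, zero_mul]
    · obtain ⟨a, ha, b, hb, hab⟩ := exists_ne_of_cup_ne_zero s (k + 1) (y :: l)
        (right_ne_zero_of_mul h) j (by simpa using hj)
      refine ⟨a, List.mem_cons_of_mem _ ha, b, List.mem_cons_of_mem _ hb, ?_⟩
      rwa [Nat.add_assoc, Nat.add_comm 1 j] at hab

lemma hemisphere_congr [Neg V] (G : ℕ → ℕ → V → V) (n : ℕ) (p : V) (D : ℕ)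
    (P : ℕ → List V → Prop) (h0 : P 0 [p]) (hneg : ∀ i l, P i l → P i (l.map Neg.neg))
    (hG : ∀ i < D, ∀ l, P i l → ∀ k < n, ∀ m : List V, m.length = l.length + 1 →
      (∀ z ∈ m, ∃ x ∈ l, z = G i k x ∨ z = G i (k + 1) x) → P (i + 1) m)
    {i : ℕ} (hi : i ≤ D) {φ ψ : List V → ZMod 2} (h : ∀ l, P i l → φ l = ψ l) :
    hemisphere G n p i φ = hemisphere G n p i ψ := by
  induction i generalizing φ ψ with
  | zero => exact h _ h0
  | succ i ih =>
    have key : ∀ l, P i l → homotopy (G i) n φ l = homotopy (G i) n ψ l := fun l hl =>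
      Finset.sum_congr rfl fun k hk => prism_congr _ _ fun m hm hz =>
        h m (hG i hi l hl k (Finset.mem_range.1 hk) m hm hz)
    refine ih (by omega) fun l hl => ?_
    rw [addNeg, addNeg, key l hl, key _ (hneg i l hl)]

/-- The combinatorial core of the Borsuk–Ulam theorem: some simplex of the hemisphere of dimension
`D` has a sign change in each of the `D` antipodal colourings `s k`. -/
lemma exists_cup_ne_zero [InvolutiveNeg V] (G : ℕ → ℕ → V → V) (n : ℕ) (p : V) (D : ℕ)
    (P : ℕ → List V → Prop) (h0 : P 0 [p]) (hneg : ∀ i l, P i l → P i (l.map Neg.neg))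
    (hG : ∀ i < D, ∀ l, P i l → ∀ k < n, ∀ m : List V, m.length = l.length + 1 →
      (∀ z ∈ m, ∃ x ∈ l, z = G i k x ∨ z = G i (k + 1) x) → P (i + 1) m)
    (hG0 : ∀ i x, G i 0 x = x) (hGn : ∀ i x y, G i n x = G i n y)
    (s : ℕ → V → ZMod 2) (hP : ∀ i l, P i l → l ≠ [])
    (hs : ∀ i l, P i l → ∀ x ∈ l, ∀ k, s k (-x) = s k x + 1) :
    ∃ l, P D l ∧ cup s 0 l ≠ 0 := by
  have key : ∀ i ≤ D, ∀ k, hemisphere G n p i (cup s k) = 1 := by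
    intro i
    induction i with
    | zero => intro _ k; simp [hemisphere, cup]
    | succ i ih =>
      intro hi k
      rw [← coboundary_cupPrimitive, hemisphere_coboundary G n p hG0 hGn, ← ih (by omega) (k + 1)]
      exact hemisphere_congr G n p D P h0 hneg hG (by omega) fun l hl =>
        addNeg_cupPrimitive s k l (hP i l hl) fun k x hx => hs i l hl x hx k
  by_contra! hcon
  have h1 := key D le_rfl 0
  rw [hemisphere_congr G n p D P h0 hneg hG le_rfl (ψ := 0) hcon, hemisphere_zero] at h1
  exact zero_ne_one h1

end Cochain

section BorsukUlam

variable {N : ℕ}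

/-- The `i`-th coordinate vector, indexed by the natural numbers. -/
def coordVec (N i : ℕ) : Fin N → ℝ := fun j => if (j : ℕ) = i then 1 else 0

/-- The `ℓ¹` unit sphere of the span of the first `i + 1` coordinate vectors. -/
def crossSphere (N i : ℕ) : Set (Fin N → ℝ) :=
  {x | ∑ j, |x j| = 1 ∧ ∀ j : Fin N, i < j → x j = 0}

/-- The segment from `x` to the coordinate vector `i + 1`, in `n` steps. -/
noncomputable def stepTo (N n i k : ℕ) (x : Fin N → ℝ) : Fin N → ℝ :=
  (1 - (k : ℝ) / n) • x + ((k : ℝ) / n) • coordVec N (i + 1)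

lemma norm_coordVec_le (i : ℕ) : ‖coordVec N i‖ ≤ 1 := by
  refine (pi_norm_le_iff_of_nonneg zero_le_one).2 fun j => ?_
  rw [coordVec]
  split_ifs <;> simp

lemma norm_le_one_of_mem_crossSphere {i : ℕ} {x : Fin N → ℝ} (hx : x ∈ crossSphere N i) :
    ‖x‖ ≤ 1 := by
  refine (pi_norm_le_iff_of_nonneg zero_le_one).2 fun j => ?_
  rw [← hx.1, Real.norm_eq_abs]
  exact Finset.single_le_sum (f := fun j => |x j|) (fun _ _ => abs_nonneg _) (Finset.mem_univ j)

lemma ne_zero_of_mem_crossSphere {i : ℕ} {x : Fin N → ℝ} (hx : x ∈ crossSphere N i) : x ≠ 0 := by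
  rintro rfl
  simpa using hx.1

lemma neg_mem_crossSphere {i : ℕ} {x : Fin N → ℝ} (hx : x ∈ crossSphere N i) :
    -x ∈ crossSphere N i := by
  simpa [crossSphere] using hx

lemma coordVec_zero_mem_crossSphere (hN : 0 < N) : coordVec N 0 ∈ crossSphere N 0 := by
  constructor
  · rw [Finset.sum_eq_single (⟨0, hN⟩ : Fin N)]
    · simp [coordVec]
    · intro j _ hj
      have : (j : ℕ) ≠ 0 := fun h => hj (Fin.ext h)
      simp [coordVec, this]
    · simp
  · intro j hj
    simp [coordVec, hj.ne']

lemma stepTo_mem_crossSphere {n i k : ℕ} (hi : i + 1 < N) (hk : k ≤ n) (hn : 0 < n)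
    {x : Fin N → ℝ} (hx : x ∈ crossSphere N i) : stepTo N n i k x ∈ crossSphere N (i + 1) := by
  have hn' : (0 : ℝ) < n := by exact_mod_cast hn
  have h0 : 0 ≤ (k : ℝ) / n := by positivity
  have h1 : (k : ℝ) / n ≤ 1 := by
    rw [div_le_one hn']; exact_mod_cast hk
  constructor
  · have : ∀ j : Fin N, |stepTo N n i k x j| =
        (1 - (k : ℝ) / n) * |x j| + ((k : ℝ) / n) * coordVec N (i + 1) j := by
      intro j
      simp only [stepTo, coordVec, Pi.add_apply, Pi.smul_apply, smul_eq_mul]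
      split_ifs with hj
      · rw [hx.2 j (by omega)]
        simp [abs_of_nonneg h0]
      · simp [abs_mul, abs_of_nonneg (sub_nonneg.2 h1)]
    have hsum : ∑ j : Fin N, coordVec N (i + 1) j = 1 := by
      rw [Finset.sum_eq_single (⟨i + 1, hi⟩ : Fin N)]
      · simp [coordVec]
      · intro j _ hj
        have : (j : ℕ) ≠ i + 1 := fun h => hj (Fin.ext h)
        simp [coordVec, this]
      · simp
    rw [Finset.sum_congr rfl fun j _ => this j, Finset.sum_add_distrib, ← Finset.mul_sum,
      ← Finset.mul_sum, hx.1, hsum]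
    ring
  · intro j hj
    simp [stepTo, coordVec, hx.2 j (by omega), show (j : ℕ) ≠ i + 1 by omega]

lemma dist_stepTo_le {n i k k' : ℕ} (hk : k ≤ n) (hn : 0 < n) (hkk : |(k : ℝ) - k'| ≤ 1)
    {x y : Fin N → ℝ} (hy : ‖y‖ ≤ 1) :
    dist (stepTo N n i k x) (stepTo N n i k' y) ≤ dist x y + 2 / n := by
  have hn' : (0 : ℝ) < n := by exact_mod_cast hn
  have h0 : 0 ≤ (k : ℝ) / n := by positivity
  have h1 : (k : ℝ) / n ≤ 1 := by
    rw [div_le_one hn']; exact_mod_cast hk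
  have heq : stepTo N n i k x - stepTo N n i k' y = (1 - (k : ℝ) / n) • (x - y) +
      (((k : ℝ) - k') / n) • (coordVec N (i + 1) - y) := by
    simp only [stepTo, sub_div]
    module
  rw [dist_eq_norm, heq, dist_eq_norm]
  refine (norm_add_le _ _).trans (add_le_add ?_ ?_)
  · rw [norm_smul, Real.norm_eq_abs, abs_of_nonneg (sub_nonneg.2 h1)]
    exact mul_le_of_le_one_left (norm_nonneg _) (by linarith)
  · have h2 : ‖coordVec N (i + 1) - y‖ ≤ 2 :=
      (norm_sub_le _ _).trans (by linarith [norm_coordVec_le (N := N) (i + 1)])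
    rw [norm_smul, Real.norm_eq_abs, abs_div, abs_of_pos hn', div_mul_eq_mul_div]
    gcongr
    nlinarith [abs_nonneg ((k : ℝ) - k'), norm_nonneg (coordVec N (i + 1) - y)]

lemma isCompact_crossSphere (N i : ℕ) : IsCompact (crossSphere N i) := by
  refine Metric.isCompact_of_isClosed_isBounded ?_ ?_
  · have heq : crossSphere N i =
        {x | ∑ j, |x j| = 1} ∩ ⋂ j : Fin N, ⋂ _ : i < j, {x | x j = 0} := by
      ext x
      simp [crossSphere]
    rw [heq]
    refine IsClosed.inter (isClosed_eq (by fun_prop) continuous_const) ?_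
    exact isClosed_iInter fun j => isClosed_iInter fun _ =>
      isClosed_eq (continuous_apply j) continuous_const
  · exact (Metric.isBounded_closedBall (x := 0) (r := 1)).subset fun x hx => by
      simpa using norm_le_one_of_mem_crossSphere hx

/-- An antipodal colouring of the nonzero vectors which is a weak sign of the odd function `h`. -/
lemma exists_sign_colouring (h : (Fin N → ℝ) → ℝ) (hodd : ∀ x, h (-x) = -h x) :
    ∃ s : (Fin N → ℝ) → ZMod 2, (∀ x ≠ 0, s (-x) = s x + 1) ∧
      ∀ x y, s x ≠ s y → h x * h y ≤ 0 := by
  classical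
  let p : (Fin N → ℝ) → Prop := fun x => 0 < h x ∨ (h x = 0 ∧ WellOrderingRel x (-x))
  refine ⟨fun x => if p x then 1 else 0, fun x hx => ?_, fun x y hxy => ?_⟩
  · have hp : p (-x) ↔ ¬ p x := by
      have hne : x ≠ -x := fun hx' => hx (self_eq_neg.1 hx')
      have htri := trichotomous_of WellOrderingRel x (-x)
      have hasymm : WellOrderingRel x (-x) → ¬ WellOrderingRel (-x) x := fun a b =>
        asymm_of WellOrderingRel a b
      simp only [p, hodd, neg_neg]
      rcases lt_trichotomy (h x) 0 with h' | h' | h'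
      · simp [h', h'.le, h'.ne]
      · simp only [h', lt_irrefl, neg_zero]
        tauto
      · simp [h', h'.le, h'.ne']
    by_cases hx : p x
    · simp [hp, hx, CharTwo.add_self_eq_zero]
    · simp [hp, hx]
  · have hp1 : ∀ x, p x → 0 ≤ h x := fun x hx => hx.elim le_of_lt fun hx => hx.1.ge
    have hp2 : ∀ x, ¬ p x → h x ≤ 0 := fun x hx => not_lt.1 fun h' => hx (.inl h')
    by_cases hx : p x <;> by_cases hy : p y
    · simp [hx, hy] at hxy
    · exact mul_nonpos_of_nonneg_of_nonpos (hp1 x hx) (hp2 y hy)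
    · exact mul_nonpos_of_nonpos_of_nonneg (hp2 x hx) (hp1 y hy)
    · simp [hx, hy] at hxy

/-- The **Borsuk–Ulam theorem**: an odd map `ℝᴺ⁺¹ → ℝᴺ` which is continuous away from the origin
vanishes at some nonzero vector. -/
theorem exists_ne_zero_eq_zero_of_odd (h : (Fin (N + 1) → ℝ) → Fin N → ℝ)
    (hcont : ContinuousOn h {0}ᶜ) (hodd : ∀ x, h (-x) = -h x) : ∃ x ≠ 0, h x = 0 := by
  by_contra! hne
  set K := crossSphere (N + 1) N
  have hK0 : K ⊆ {0}ᶜ := fun x hx => ne_zero_of_mem_crossSphere hx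
  have hKc : IsCompact K := isCompact_crossSphere _ _
  have hc : ContinuousOn h K := hcont.mono hK0
  obtain ⟨c, hc0, hcK⟩ : ∃ c > 0, ∀ x ∈ K, c ≤ ‖h x‖ :=
    hKc.exists_forall_le' hc.norm fun x hx => norm_pos_iff.2 (hne x (hK0 hx))
  obtain ⟨δ, hδ, hunif⟩ := Metric.uniformContinuousOn_iff.1
    (hKc.uniformContinuousOn_of_continuous hc) (c / 2) (half_pos hc0)
  obtain ⟨n, hn⟩ := exists_nat_gt (2 * N / δ)
  have hn0 : 0 < n := by
    have : (0 : ℝ) < n := lt_of_le_of_lt (by positivity) hn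
    exact_mod_cast this
  have hn' : (0 : ℝ) < n := by exact_mod_cast hn0
  have hex := fun k : ℕ => exists_sign_colouring (fun x => if hk : k < N then h x ⟨k, hk⟩ else 0)
    (fun x => by split_ifs <;> simp [hodd])
  choose s hs hsign using hex
  let P : ℕ → List (Fin (N + 1) → ℝ) → Prop := fun i l => l.length = i + 1 ∧
    (∀ x ∈ l, x ∈ crossSphere (N + 1) i) ∧ ∀ x ∈ l, ∀ y ∈ l, dist x y ≤ i * (2 / n)
  obtain ⟨l, ⟨hlen, hlK, hld⟩, hcup⟩ := Cochain.exists_cup_ne_zero (stepTo (N + 1) n) n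
    (coordVec (N + 1) 0) N P
    ⟨rfl, by simpa using coordVec_zero_mem_crossSphere N.succ_pos, by simp⟩
    (by
      rintro i l ⟨h1, h2, h3⟩
      refine ⟨by simpa using h1, ?_, ?_⟩
      · simp only [List.mem_map]
        rintro _ ⟨x, hx, rfl⟩
        exact neg_mem_crossSphere (h2 x hx)
      · simp only [List.mem_map]
        rintro _ ⟨x, hx, rfl⟩ _ ⟨y, hy, rfl⟩
        rw [dist_neg_neg]
        exact h3 x hx y hy)
    (by
      rintro i hi l ⟨h1, h2, h3⟩ k hk m hm hz
      have hz' : ∀ z ∈ m, ∃ x ∈ l, ∃ k', k ≤ k' ∧ k' ≤ k + 1 ∧ z = stepTo (N + 1) n i k' x := by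
        intro z hzm
        obtain ⟨x, hx, rfl | rfl⟩ := hz z hzm
        · exact ⟨x, hx, k, le_rfl, by omega, rfl⟩
        · exact ⟨x, hx, k + 1, by omega, le_rfl, rfl⟩
      refine ⟨by omega, fun z hzm => ?_, fun z hzm w hwm => ?_⟩
      · obtain ⟨x, hx, k', -, hk', rfl⟩ := hz' z hzm
        exact stepTo_mem_crossSphere (by omega) (by omega) hn0 (h2 x hx)
      · obtain ⟨x, hx, k₁, hk₁, hk₁', rfl⟩ := hz' z hzm
        obtain ⟨y, hy, k₂, hk₂, hk₂', rfl⟩ := hz' w hwm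
        have hkk : |(k₁ : ℝ) - k₂| ≤ 1 := by
          have e1 : (k₁ : ℝ) ≤ k + 1 := by exact_mod_cast hk₁'
          have e2 : (k₂ : ℝ) ≤ k + 1 := by exact_mod_cast hk₂'
          have e3 : (k : ℝ) ≤ k₁ := by exact_mod_cast hk₁
          have e4 : (k : ℝ) ≤ k₂ := by exact_mod_cast hk₂
          rw [abs_le]
          constructor <;> linarith
        have h4 := dist_stepTo_le (i := i) (by omega) hn0 hkk (x := x)
          (norm_le_one_of_mem_crossSphere (h2 y hy))
        have h5 := h3 x hx y hy
        push_cast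
        linarith)
    (fun i x => by simp [stepTo])
    (fun i x y => by simp [stepTo, hn'.ne'])
    s
    (fun i l hl hnil => by simp [P, hnil] at hl)
    (fun i l hl x hx k => hs k x (ne_zero_of_mem_crossSphere (hl.2.1 x hx)))
  have hclose : ∀ x ∈ l, ∀ y ∈ l, dist (h x) (h y) < c / 2 := fun x hx y hy => by
    refine hunif x (hlK x hx) y (hlK y hy) ((hld x hx y hy).trans_lt ?_)
    rw [div_lt_iff₀ hδ] at hn
    rw [← mul_div_assoc, div_lt_iff₀ hn']
    linarith
  obtain ⟨x₀, hx₀⟩ : ∃ x, x ∈ l := List.exists_mem_of_length_pos (by omega)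
  refine (hcK x₀ (hlK x₀ hx₀)).not_gt ((pi_norm_lt_iff hc0).2 fun j => ?_)
  obtain ⟨x, hx, y, hy, hxy⟩ := Cochain.exists_ne_of_cup_ne_zero s 0 l hcup j (by omega)
  have hmul := hsign _ x y hxy
  simp only [zero_add, j.2, dite_true, Fin.eta] at hmul
  have d1 := (dist_le_pi_dist (h x) (h y) j).trans_lt (hclose x hx y hy)
  have d2 := (dist_le_pi_dist (h x₀) (h x) j).trans_lt (hclose x₀ hx₀ x hx)
  rw [Real.dist_eq, abs_lt] at d1 d2
  rw [Real.norm_eq_abs, abs_lt]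
  rcases mul_nonpos_iff.1 hmul with ⟨a, b⟩ | ⟨a, b⟩ <;> constructor <;> linarith

end BorsukUlam

/-- Finitely many continuous functions on the unit sphere of an infinite-dimensional normed space
take equal values at some pair of antipodal points. -/
lemma exists_norm_eq_one_forall_eq_neg {E : Type*} [NormedAddCommGroup E] [NormedSpace ℝ E]
    (hE : ¬ FiniteDimensional ℝ E) (N : ℕ) (F : E → Fin N → ℝ) (hF : Continuous F) :
    ∃ y : E, ‖y‖ = 1 ∧ F y = F (-y) := by
  obtain ⟨v, hv⟩ : ∃ v : Fin (N + 1) → E, LinearIndependent ℝ v := by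
    let b := Module.Basis.ofVectorSpace ℝ E
    have : Infinite (Module.Basis.ofVectorSpaceIndex ℝ E) := by
      by_contra hfin
      rw [not_infinite_iff_finite] at hfin
      exact hE (Module.Finite.of_basis b)
    let g := (Fin.valEmbedding (n := N + 1)).trans
      (Infinite.natEmbedding (Module.Basis.ofVectorSpaceIndex ℝ E))
    exact ⟨b ∘ g, b.linearIndependent.comp g g.injective⟩
  let T := Fintype.linearCombination ℝ v
  have hT0 : ∀ x ≠ 0, T x ≠ 0 := fun x hx h0 =>
    hx (hv.fintypeLinearCombination_injective (h0.trans (map_zero T).symm))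
  have hTc : Continuous T := T.continuous_of_finiteDimensional
  let S : (Fin (N + 1) → ℝ) → E := fun x => ‖T x‖⁻¹ • T x
  have hS : ContinuousOn S {0}ᶜ := fun x hx =>
    ((hTc.norm.continuousAt.inv₀ (norm_ne_zero_iff.2 (hT0 x hx))).smul
      hTc.continuousAt).continuousWithinAt
  have hSneg : ∀ x, S (-x) = -S x := fun x => by simp [S]
  obtain ⟨x, hx, hx0⟩ := exists_ne_zero_eq_zero_of_odd (fun x => F (S x) - F (-S x))
    ((hF.comp_continuousOn hS).sub (hF.comp_continuousOn hS.neg))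
    (fun x => by simp [hSneg])
  exact ⟨S x, by simp [S, norm_smul, hT0 x hx], sub_eq_zero.1 hx0⟩

lemma abs_apply_sub_le_norm_sub (g g' : C₀(ℕ, ℝ)) (n : ℕ) : |g n - g' n| ≤ ‖g - g'‖ := by
  rw [← ZeroAtInftyContinuousMap.norm_toBCF_eq_norm]
  exact (g - g').toBCF.norm_coe_le_norm n

/-- If `X` is a Banach space, `u ∈ S_X`, and `Y` is an infinite-dimensional closed subspace with
`inf {‖u + 2y‖ : y ∈ S_Y} > λ`, then there is no λ-embedding from `X` into the positive
cone `c₀⁺` of `c₀`. -/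
theorem stmt15 {X : Type*} [NormedAddCommGroup X] [NormedSpace ℝ X] [CompleteSpace X]
    (lam : ℝ) (hlam : 1 ≤ lam) (u : X) (hu : ‖u‖ = 1)
    (Y : Subspace ℝ X) (hYclosed : IsClosed (Y : Set X)) (hYinf : ¬ FiniteDimensional ℝ Y)
    (hgap : lam < sInf {r : ℝ | ∃ y ∈ Y, ‖y‖ = 1 ∧ r = ‖u + 2 • y‖}) :
    ¬ ∃ f : X → C₀(ℕ, ℝ), (∀ (x : X) (n : ℕ), 0 ≤ f x n) ∧ LambdaEmbedding lam f := by
  rintro ⟨f, hpos, hf⟩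
  set r := sInf {r : ℝ | ∃ y ∈ Y, ‖y‖ = 1 ∧ r = ‖u + 2 • y‖}
  have hlip : ∀ x y n, |f x n - f y n| ≤ lam * ‖x - y‖ := fun x y n =>
    (abs_apply_sub_le_norm_sub _ _ n).trans ((hf x y).2.trans_eq (by rw [dist_eq_norm]))
  have htail : ∀ x, ∀ᶠ n in Filter.atTop, f x n < (r - lam) / 2 := fun x => by
    have h := (f x).zero_at_infty'
    rw [Filter.cocompact_eq_cofinite, Nat.cofinite_eq_atTop] at h
    exact h.eventually_lt_const (by linarith)
  obtain ⟨N, hN⟩ := Filter.eventually_atTop.1 ((htail 0).and (htail u))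
  obtain ⟨y, hy1, hy⟩ := exists_norm_eq_one_forall_eq_neg hYinf N (fun y n => f (y : X) n) <| by
    refine continuous_pi fun n => LipschitzWith.continuous (K := lam.toNNReal) <|
      LipschitzWith.of_dist_le_mul fun x y => ?_
    rw [Real.coe_toNNReal lam (by linarith), Real.dist_eq, dist_eq_norm]
    exact hlip x y n
  have hy1' : ‖(y : X)‖ = 1 := hy1
  have hle : r ≤ ‖u + 2 • (y : X)‖ :=
    csInf_le ⟨0, by rintro _ ⟨z, -, -, rfl⟩; positivity⟩ ⟨y, y.2, hy1', rfl⟩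
  have hge : ‖f (u + y) - f (-y)‖ ≤ lam + (r - lam) / 2 := by
    rw [← ZeroAtInftyContinuousMap.norm_toBCF_eq_norm]
    refine (BoundedContinuousFunction.norm_le (by linarith)).2 fun n => ?_
    change |f (u + y) n - f (-y) n| ≤ _
    rcases lt_or_ge n N with hn | hn
    · have h1 : f (y : X) n = f (-y : X) n := congrFun hy ⟨n, hn⟩
      have h2 := hlip (u + y) y n
      rw [add_sub_cancel_right, hu] at h2
      rw [← h1]
      linarith
    · have h1 := hlip (u + y) u n
      have h2 := hlip (-y) 0 n
      rw [add_sub_cancel_left, hy1', abs_le] at h1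
      rw [sub_zero, norm_neg, hy1', abs_le] at h2
      have h3 := hN n hn
      have h4 := hpos (u + y) n
      have h5 := hpos (-y) n
      rw [abs_le]
      constructor <;> linarith
  have hdist := (hf (u + y) (-y)).1
  rw [dist_eq_norm, sub_neg_eq_add, add_assoc, ← two_nsmul] at hdist
  linarith
end

section
/- Every nonempty metric space (M,d) has property π⁺(3). -/
open Metric Set ZeroAtInfty

/-- Property π⁺(λ). -/
def PropertyPiPlus (M : Type*) [MetricSpace M] (lam : ℝ) : Prop :=
  (∀ (a₁ a₂ : M) (r₁ r₂ : ℝ), 0 < r₁ → 0 < r₂ → ∀ E : Set (M × M),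
    E.Nonempty → E ⊆ (closedBall a₁ r₁) ×ˢ (closedBall a₂ r₂) →
    lam * max r₁ r₂ < pairGap E →
    ∃ (N : ℕ) (Es : Fin N → Set (M × M)), IsPartition Es E ∧
      ∀ n, pairDiam (Es n) < lam * pairGap (pairRect (Es n))) ∧
  (∃ θ : ℝ, θ < lam ∧ ∃ φ : M → ℝ, (∀ x, 0 ≤ φ x) ∧
    ∀ x y : M, |φ x - φ y| ≤ dist x y ∧ dist x y ≤ θ * max (φ x) (φ y))

/-- The fibres over `E` of a map taking finitely many values on `E` partition `E`. -/
theorem exists_isPartition_fibres {α β : Type*} (f : α → β) (E : Set α) (hf : (f '' E).Finite) :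
    ∃ (N : ℕ) (Es : Fin N → Set α), IsPartition Es E ∧
      ∀ n, ∃ b, ∀ p ∈ Es n, p ∈ E ∧ f p = b := by
  have := hf.to_subtype
  let e := Finite.equivFin (f '' E)
  refine ⟨_, fun n => {p ∈ E | f p = e.symm n}, ⟨fun n => ?_, ?_, fun i j hij => ?_⟩,
    fun n => ⟨_, fun p hp => hp⟩⟩
  · obtain ⟨p, hp, hpn⟩ := (e.symm n).2
    exact ⟨p, hp, hpn⟩
  · ext p
    simp only [mem_iUnion, mem_ofPred_eq]
    refine ⟨fun ⟨_, h, _⟩ => h, fun h => ⟨e ⟨f p, mem_image_of_mem f h⟩, h, ?_⟩⟩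
    rw [e.symm_apply_apply]
  · refine disjoint_left.2 fun p hi hj => hij ?_
    exact e.symm.injective (Subtype.ext (hi.2.symm.trans hj.2))

/-- The gap of a set is a lower bound for the distances of its pairs. -/
theorem pairGap_le_dist {M : Type*} [MetricSpace M] {E : Set (M × M)} {p : M × M} (hp : p ∈ E) :
    pairGap E ≤ dist p.1 p.2 :=
  csInf_le ⟨0, by rintro _ ⟨q, -, rfl⟩; exact dist_nonneg⟩ (mem_image_of_mem _ hp)

/-- If all pairs in a subset of `M × closedBall a r` have distance at least `c`, then its
rectangular hull has gap at least `c - 2 * r`. -/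
theorem sub_le_pairGap_pairRect {M : Type*} [MetricSpace M] {E : Set (M × M)} {a : M} {c r : ℝ}
    (hE : E.Nonempty) (hr : ∀ p ∈ E, dist p.2 a ≤ r) (hc : ∀ p ∈ E, c ≤ dist p.1 p.2) :
    c - 2 * r ≤ pairGap (pairRect E) := by
  refine le_csInf (((hE.image _).prod (hE.image _)).image _) ?_
  rintro _ ⟨⟨x, y⟩, ⟨⟨p, hp, rfl⟩, ⟨q, hq, rfl⟩⟩, rfl⟩
  have h₁ := dist_triangle p.1 q.2 p.2
  have h₂ := dist_triangle_right q.2 p.2 a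
  have h₃ := hr p hp
  have h₄ := hr q hq
  have h₅ := hc p hp
  show c - 2 * r ≤ dist p.1 q.2
  linarith

/-- Every nonempty metric space has property π⁺(3). -/
theorem stmt16 (M : Type*) [MetricSpace M] [Nonempty M] : PropertyPiPlus M 3 := by
  obtain ⟨o⟩ := ‹Nonempty M›
  refine ⟨fun a₁ a₂ r₁ r₂ _ _ E _ hE hgap => ?_, 2, by norm_num, fun x => dist x o,
    fun _ => dist_nonneg, fun x y => ⟨abs_dist_sub_le x y o, ?_⟩⟩
  · set g := pairGap E
    set r := max r₁ r₂
    obtain ⟨ε, hε⟩ : ∃ ε, ε = g - 3 * r := ⟨_, rfl⟩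
    have hε0 : 0 < ε := by linarith
    let f : M × M → ℕ := fun p => ⌊(dist p.1 p.2 - g) / ε⌋₊
    have hfin : (f '' E).Finite := by
      refine (finite_Iic ⌊(r₁ + dist a₁ a₂ + r₂ - g) / ε⌋₊).subset ?_
      rintro _ ⟨p, hp, rfl⟩
      obtain ⟨h₁, h₂⟩ := hE hp
      rw [mem_closedBall] at h₁ h₂
      have := dist_triangle4_right p.1 p.2 a₁ a₂
      refine Nat.floor_le_floor (div_le_div_of_nonneg_right ?_ hε0.le)
      linarith
    obtain ⟨N, Es, hpart, hEs⟩ := exists_isPartition_fibres f E hfin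
    refine ⟨N, Es, hpart, fun n => ?_⟩
    obtain ⟨k, hk⟩ := hEs n
    have hlow : ∀ p ∈ Es n, g + k * ε ≤ dist p.1 p.2 := fun p hp => by
      obtain ⟨hpE, rfl⟩ := hk p hp
      have h := Nat.floor_le
        (div_nonneg (sub_nonneg.2 (pairGap_le_dist hpE)) hε0.le : 0 ≤ (dist p.1 p.2 - g) / ε)
      have := (le_div_iff₀ hε0).1 h
      linarith
    have hup : pairDiam (Es n) ≤ g + (k + 1) * ε := by
      refine csSup_le ((hpart.1 n).image _) ?_
      rintro _ ⟨p, hp, rfl⟩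
      obtain ⟨-, rfl⟩ := hk p hp
      have := (div_lt_iff₀ hε0).1 (Nat.lt_floor_add_one ((dist p.1 p.2 - g) / ε))
      simp only [f]
      linarith
    have hrect := sub_le_pairGap_pairRect (a := a₂) (r := r) (hpart.1 n)
      (fun p hp => (mem_closedBall.1 (hE (hk p hp).1).2).trans (le_max_right _ _)) hlow
    have : 0 ≤ k * ε := by positivity
    linarith
  · have := dist_triangle_right x y o
    have := le_max_left (dist x o) (dist y o)
    have := le_max_right (dist x o) (dist y o)
    show dist x y ≤ 2 * max (dist x o) (dist y o)
    linarith
end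

section
/- Let 1 ≤ p < ∞. Then ℓᵖ(ℕ) has property π⁺((1 + 2ᵖ)^{1/p}). -/
open Metric Set ZeroAtInfty

/-- A set mapped into a compact set has a finite partition into pieces whose images have
diameter at most `ε`. -/
lemma exists_isPartition_dist_le {α X : Type*} [PseudoMetricSpace X] (g : α → X) {E : Set α}
    {K : Set X} (hK : IsCompact K) (hg : ∀ a ∈ E, g a ∈ K) {ε : ℝ} (hε : 0 < ε) :
    ∃ (N : ℕ) (Es : Fin N → Set α), IsPartition Es E ∧
      ∀ n, ∀ a ∈ Es n, ∀ b ∈ Es n, dist (g a) (g b) ≤ ε := by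
  obtain ⟨t, -, htf, ht⟩ := hK.finite_cover_balls (half_pos hε)
  have hc : ∀ a : α, ∃ x : X, a ∈ E → x ∈ t ∧ dist (g a) x < ε / 2 := by
    intro a
    by_cases ha : a ∈ E
    · obtain ⟨x, hx, hax⟩ := mem_iUnion₂.1 (ht (hg a ha))
      exact ⟨x, fun _ => ⟨hx, hax⟩⟩
    · exact ⟨g a, fun h => absurd h ha⟩
  choose c hc using hc
  have hfin : (c '' E).Finite := htf.subset (by rintro _ ⟨a, ha, rfl⟩; exact (hc a ha).1)
  have := hfin.fintype
  let e := (Fintype.equivFin (c '' E)).symm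
  refine ⟨Fintype.card (c '' E), fun n => {a | a ∈ E ∧ c a = e n}, ⟨?_, ?_, ?_⟩, ?_⟩
  · intro n
    obtain ⟨a, ha, h⟩ := (e n).2
    exact ⟨a, ha, h⟩
  · ext a
    simp only [mem_iUnion, mem_ofPred_eq]
    refine ⟨fun ⟨_, h, _⟩ => h, fun ha => ⟨e.symm ⟨c a, a, ha, rfl⟩, ha, ?_⟩⟩
    rw [Equiv.apply_symm_apply]
  · intro i j hij
    rw [Set.disjoint_left]
    rintro a ⟨-, h1⟩ ⟨-, h2⟩
    exact hij (e.injective (Subtype.ext (h1.symm.trans h2)))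
  · rintro n a ⟨ha, h1⟩ b ⟨hb, h2⟩
    have h3 := (hc a ha).2
    have h4 := (hc b hb).2
    rw [h1] at h3
    rw [h2] at h4
    linarith [dist_triangle_right (g a) (g b) (e n : X)]

/-- The projection of `ℓᵖ(ℕ)` onto its first `n` coordinates. -/
noncomputable def lpTruncate (p : ENNReal) [Fact (1 ≤ p)] (n : ℕ) :
    lp (fun _ : ℕ => ℝ) p →L[ℝ] lp (fun _ : ℕ => ℝ) p :=
  ∑ i ∈ Finset.range n,
    (lp.singleContinuousLinearMap ℝ (fun _ : ℕ => ℝ) p i).comp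
      (lp.evalCLM ℝ (fun _ : ℕ => ℝ) p i)

section Truncate

variable {p : ENNReal} [Fact (1 ≤ p)]

lemma lpTruncate_apply (n : ℕ) (x : lp (fun _ : ℕ => ℝ) p) :
    lpTruncate p n x = ∑ i ∈ Finset.range n, lp.single p i (x i) := by
  simp [lpTruncate]
  rfl

lemma one_le_toReal_of_fact (hp : p ≠ ⊤) : 1 ≤ p.toReal := by
  simpa using ENNReal.toReal_mono hp (Fact.out : 1 ≤ p)

lemma norm_lpTruncate_rpow_add (hp : p ≠ ⊤) (n : ℕ) (x : lp (fun _ : ℕ => ℝ) p) :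
    ‖lpTruncate p n x‖ ^ p.toReal + ‖x - lpTruncate p n x‖ ^ p.toReal = ‖x‖ ^ p.toReal := by
  have hq : 0 < p.toReal := one_pos.trans_le (one_le_toReal_of_fact hp)
  rw [lpTruncate_apply, lp.norm_sum_single hq]
  linarith [lp.norm_sub_norm_compl_sub_single hq x (Finset.range n)]

lemma norm_lpTruncate_le (hp : p ≠ ⊤) (n : ℕ) (x : lp (fun _ : ℕ => ℝ) p) :
    ‖lpTruncate p n x‖ ≤ ‖x‖ := by
  have hq : 0 < p.toReal := one_pos.trans_le (one_le_toReal_of_fact hp)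
  rw [← Real.rpow_le_rpow_iff (norm_nonneg _) (norm_nonneg _) hq,
    ← norm_lpTruncate_rpow_add hp n x]
  exact le_add_of_nonneg_right (by positivity)

lemma norm_sub_lpTruncate_le (hp : p ≠ ⊤) (n : ℕ) (x : lp (fun _ : ℕ => ℝ) p) :
    ‖x - lpTruncate p n x‖ ≤ ‖x‖ := by
  have hq : 0 < p.toReal := one_pos.trans_le (one_le_toReal_of_fact hp)
  rw [← Real.rpow_le_rpow_iff (norm_nonneg _) (norm_nonneg _) hq,
    ← norm_lpTruncate_rpow_add hp n x]
  exact le_add_of_nonneg_left (by positivity)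

lemma tendsto_norm_sub_lpTruncate (hp : p ≠ ⊤) (x : lp (fun _ : ℕ => ℝ) p) :
    Filter.Tendsto (fun n => ‖x - lpTruncate p n x‖) Filter.atTop (nhds 0) := by
  have h := (lp.hasSum_single hp x).tendsto_sum_nat
  simp_rw [← lpTruncate_apply] at h
  simpa using (tendsto_const_nhds.sub h : Filter.Tendsto (fun n => x - lpTruncate p n x) _ _).norm

lemma exists_isCompact_lpTruncate_mem (n : ℕ) (a : lp (fun _ : ℕ => ℝ) p) (r : ℝ) :
    ∃ K : Set (lp (fun _ : ℕ => ℝ) p), IsCompact K ∧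
      ∀ x ∈ closedBall a r, lpTruncate p n x ∈ K := by
  let T : (ℕ → ℝ) → lp (fun _ : ℕ => ℝ) p := fun v => ∑ i ∈ Finset.range n, lp.single p i (v i)
  have hT : Continuous T := continuous_finsetSum _ fun i _ =>
    (lp.isometry_single (E := fun _ : ℕ => ℝ) i).continuous.comp (continuous_apply i)
  refine ⟨T '' Set.univ.pi fun i => closedBall (a i) r,
    (isCompact_univ_pi fun i => isCompact_closedBall _ _).image hT, fun x hx => ?_⟩
  refine ⟨x, fun i _ => ?_, (lpTruncate_apply n x).symm⟩
  rw [mem_closedBall, dist_eq_norm] at hx ⊢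
  have h0 : p ≠ 0 := (one_pos.trans_le (Fact.out : 1 ≤ p)).ne'
  exact (lp.norm_apply_le_norm h0 (x - a) i).trans hx

end Truncate

/-- The constants used to bound the diameter of a piece in terms of its gap. -/
lemma exists_pi_constants {q R d : ℝ} (hq : 1 ≤ q) (hR : 0 < R)
    (h : (1 + (2 : ℝ) ^ q) ^ (1 / q) * R < d) :
    ∃ R' c ε : ℝ, 0 < ε ∧ R + ε ≤ R' ∧ 2 * ε < c ∧ c ^ q + (2 * R') ^ q ≤ d ^ q ∧
      ((c + 2 * ε) / (c - 2 * ε)) ^ q + (2 * R' / (c - 2 * ε)) ^ q < 1 + 2 ^ q := by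
  have hq0 : 0 < q := by linarith
  set l := (1 + (2 : ℝ) ^ q) ^ (1 / q) with hl
  have hl0 : 0 < l := by positivity
  have hlq : l ^ q = 1 + 2 ^ q := by
    rw [hl, one_div, Real.rpow_inv_rpow (by positivity) hq0.ne']
  obtain ⟨R', hRR', hR'd⟩ := exists_between ((lt_div_iff₀' hl0).2 h)
  have hR' : 0 < R' := hR.trans hRR'
  have h1 : (1 + 2 ^ q) * R' ^ q < d ^ q := by
    rw [← hlq, ← Real.mul_rpow hl0.le hR'.le]
    exact Real.rpow_lt_rpow (by positivity) ((lt_div_iff₀' hl0).1 hR'd) hq0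
  have h2 : (2 * R') ^ q = 2 ^ q * R' ^ q := Real.mul_rpow (by norm_num) hR'.le
  have hpos : R' ^ q < d ^ q - (2 * R') ^ q := by linarith
  have hpos' : 0 < d ^ q - (2 * R') ^ q := (by positivity : 0 < R' ^ q).trans hpos
  set c := (d ^ q - (2 * R') ^ q) ^ q⁻¹ with hc
  have hcq : c ^ q = d ^ q - (2 * R') ^ q := Real.rpow_inv_rpow hpos'.le hq0.ne'
  have hc0 : 0 < c := by positivity
  have hcR : R' < c := by
    rw [← Real.rpow_lt_rpow_iff hR'.le hc0.le hq0, hcq]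
    exact hpos
  have hcont : ContinuousAt (fun ε : ℝ =>
      ((c + 2 * ε) / (c - 2 * ε)) ^ q + (2 * R' / (c - 2 * ε)) ^ q) 0 := by
    have hne : c - 2 * (0 : ℝ) ≠ 0 := by simpa using hc0.ne'
    exact (((continuousAt_const.add (continuousAt_const.mul continuousAt_id)).div
      (continuousAt_const.sub (continuousAt_const.mul continuousAt_id)) hne).rpow_const
        (Or.inr hq0.le)).add ((continuousAt_const.div
      (continuousAt_const.sub (continuousAt_const.mul continuousAt_id)) hne).rpow_const
        (Or.inr hq0.le))
  have hlt : ((c + 2 * 0) / (c - 2 * 0)) ^ q + (2 * R' / (c - 2 * 0)) ^ q < 1 + 2 ^ q := by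
    simp only [mul_zero, add_zero, sub_zero, div_self hc0.ne', Real.one_rpow]
    gcongr
    rw [div_lt_iff₀ hc0]
    linarith
  have e1 := (hcont.eventually_lt_const hlt).filter_mono
    (nhdsWithin_le_nhds (s := Set.Ioi 0))
  have e2 : ∀ᶠ ε in nhdsWithin (0 : ℝ) (Set.Ioi 0), ε < min (R' - R) (c / 2) :=
    nhdsWithin_le_nhds (eventually_lt_nhds (lt_min (by linarith) (by linarith)))
  obtain ⟨ε, ⟨h3, h4⟩, h5⟩ := ((e1.and e2).and self_mem_nhdsWithin).exists
  obtain ⟨h6, h7⟩ := lt_min_iff.1 h4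
  exact ⟨R', c, ε, h5, by linarith, by linarith, by linarith, h3⟩

lemma pairGap_le {M : Type*} [MetricSpace M] {E : Set (M × M)} {z : M × M} (hz : z ∈ E) :
    pairGap E ≤ dist z.1 z.2 :=
  csInf_le ⟨0, by rintro _ ⟨w, -, rfl⟩; exact dist_nonneg⟩ ⟨z, hz, rfl⟩

/-- A piece of `E` on which the first `n` coordinates are almost constant satisfies the
inequality of property `π⁺`. -/
lemma pairDiam_lt_mul_pairGap_pairRect {p : ENNReal} [Fact (1 ≤ p)] (hp : p ≠ ⊤)
    {F : Set (lp (fun _ : ℕ => ℝ) p × lp (fun _ : ℕ => ℝ) p)} (hF : F.Nonempty)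
    {n : ℕ} {d R' c ε : ℝ} (hR' : 0 ≤ R') (hd : 0 ≤ d) (hε : 0 < ε) (hεc : 2 * ε < c)
    (hcd : c ^ p.toReal + (2 * R') ^ p.toReal ≤ d ^ p.toReal)
    (hlt : ((c + 2 * ε) / (c - 2 * ε)) ^ p.toReal + (2 * R' / (c - 2 * ε)) ^ p.toReal <
      1 + 2 ^ p.toReal)
    (hdF : ∀ z ∈ F, d ≤ dist z.1 z.2)
    (htail : ∀ z ∈ F, ‖(z.1 - z.2) - lpTruncate p n (z.1 - z.2)‖ ≤ 2 * R')
    (hhead : ∀ z ∈ F, ∀ w ∈ F, dist (lpTruncate p n z.1, lpTruncate p n z.2)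
      (lpTruncate p n w.1, lpTruncate p n w.2) ≤ ε) :
    pairDiam F < (1 + (2 : ℝ) ^ p.toReal) ^ (1 / p.toReal) * pairGap (pairRect F) := by
  have hq : 0 < p.toReal := one_pos.trans_le (one_le_toReal_of_fact hp)
  set q := p.toReal
  set P := lpTruncate p n with hP
  obtain ⟨z₀, hz₀⟩ := hF
  set D := ‖P z₀.1 - P z₀.2‖ with hD
  have hc : 0 < c := by linarith
  have hcD : c ≤ D := by
    rw [← Real.rpow_le_rpow_iff hc.le (norm_nonneg _) hq]
    have h1 := Real.rpow_le_rpow hd (hdF z₀ hz₀) hq.le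
    rw [dist_eq_norm, ← norm_lpTruncate_rpow_add hp n, map_sub] at h1
    have h2 := htail z₀ hz₀
    rw [map_sub] at h2
    have h3 := Real.rpow_le_rpow (norm_nonneg _) h2 hq.le
    linarith
  have hhead1 : ∀ z ∈ F, ‖P z.1 - P z₀.1‖ ≤ ε := fun z hz => by
    rw [← dist_eq_norm]
    exact (le_max_left _ _).trans (hhead z hz z₀ hz₀)
  have hhead2 : ∀ z ∈ F, ‖P z.2 - P z₀.2‖ ≤ ε := fun z hz => by
    rw [← dist_eq_norm]
    exact (le_max_right _ _).trans (hhead z hz z₀ hz₀)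
  have hnear : ∀ z ∈ F, ∀ w ∈ F, |‖P z.1 - P w.2‖ - D| ≤ 2 * ε := by
    intro z hz w hw
    calc |‖P z.1 - P w.2‖ - D| ≤ ‖(P z.1 - P w.2) - (P z₀.1 - P z₀.2)‖ := abs_norm_sub_norm_le _ _
      _ = ‖(P z.1 - P z₀.1) - (P w.2 - P z₀.2)‖ := by congr 1; abel
      _ ≤ ‖P z.1 - P z₀.1‖ + ‖P w.2 - P z₀.2‖ := norm_sub_le _ _
      _ ≤ 2 * ε := by linarith [hhead1 z hz, hhead2 w hw]
  have hgap : D - 2 * ε ≤ pairGap (pairRect F) := by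
    refine le_csInf ?_ ?_
    · exact ⟨_, z₀, ⟨⟨z₀, hz₀, rfl⟩, ⟨z₀, hz₀, rfl⟩⟩, rfl⟩
    · rintro _ ⟨⟨x, y⟩, ⟨⟨z, hz, hzx⟩, ⟨w, hw, hwy⟩⟩, rfl⟩
      dsimp only at hzx hwy ⊢
      rw [← hzx, ← hwy, dist_eq_norm]
      refine le_trans ?_ (norm_lpTruncate_le hp n _)
      rw [map_sub]
      linarith [(abs_le.1 (hnear z hz w hw)).1]
  have hDε : 0 < D - 2 * ε := by linarith
  set A := ((c + 2 * ε) / (c - 2 * ε)) ^ q + (2 * R' / (c - 2 * ε)) ^ q with hA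
  have hcε : 0 < c - 2 * ε := by linarith
  have hA0 : 0 ≤ A := by positivity
  have hdiam : pairDiam F ≤ A ^ (1 / q) * (D - 2 * ε) := by
    refine csSup_le ⟨_, z₀, hz₀, rfl⟩ ?_
    rintro _ ⟨z, hz, rfl⟩
    beta_reduce
    rw [dist_eq_norm, ← Real.rpow_le_rpow_iff (norm_nonneg _) (by positivity) hq,
      Real.mul_rpow (by positivity) hDε.le, one_div, Real.rpow_inv_rpow hA0 hq.ne',
      ← norm_lpTruncate_rpow_add hp n, hA, add_mul, ← Real.mul_rpow (by positivity) hDε.le,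
      ← Real.mul_rpow (by positivity) hDε.le]
    refine add_le_add (Real.rpow_le_rpow (norm_nonneg _) ?_ hq.le)
      (Real.rpow_le_rpow (norm_nonneg _) ((htail z hz).trans ?_) hq.le)
    · rw [map_sub, div_mul_eq_mul_div, le_div_iff₀ hcε]
      have h1 : ‖P z.1 - P z.2‖ ≤ D + 2 * ε := by linarith [(abs_le.1 (hnear z hz z hz)).2]
      nlinarith
    · rw [div_mul_eq_mul_div, le_div_iff₀ hcε]
      gcongr
  calc pairDiam F ≤ A ^ (1 / q) * (D - 2 * ε) := hdiam
    _ < (1 + (2 : ℝ) ^ q) ^ (1 / q) * (D - 2 * ε) := by gcongr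
    _ ≤ _ := by gcongr

/-- For `1 ≤ p < ∞`, `ℓᵖ(ℕ)` has property `π⁺((1 + 2ᵖ)^(1/p))`. -/
theorem stmt17 (p : ENNReal) [Fact (1 ≤ p)] (hp : p ≠ ⊤) :
    PropertyPiPlus (lp (fun _ : ℕ => ℝ) p)
      ((1 + (2 : ℝ) ^ p.toReal) ^ (1 / p.toReal)) := by
  have hq := one_le_toReal_of_fact hp
  have hq0 : 0 < p.toReal := by linarith
  refine ⟨fun a₁ a₂ r₁ r₂ hr₁ hr₂ E hE hEsub hgap => ?_,
    2, ?_, fun x => ‖x‖, norm_nonneg, fun x y => ?_⟩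
  · have hR : 0 < max r₁ r₂ := lt_max_of_lt_left hr₁
    obtain ⟨R', c, ε, hε, hRε, hεc, hcd, hlt⟩ := exists_pi_constants hq hR hgap
    have ht := ((tendsto_norm_sub_lpTruncate hp a₁).eventually_le_const hε).and
      ((tendsto_norm_sub_lpTruncate hp a₂).eventually_le_const hε)
    obtain ⟨n, hn₁, hn₂⟩ := ht.exists
    obtain ⟨K₁, hK₁, hm₁⟩ := exists_isCompact_lpTruncate_mem n a₁ r₁
    obtain ⟨K₂, hK₂, hm₂⟩ := exists_isCompact_lpTruncate_mem n a₂ r₂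
    obtain ⟨N, Es, hEs, hclose⟩ := exists_isPartition_dist_le
      (fun z : lp (fun _ : ℕ => ℝ) p × lp (fun _ : ℕ => ℝ) p =>
        (lpTruncate p n z.1, lpTruncate p n z.2)) (hK₁.prod hK₂)
      (fun z hz => ⟨hm₁ _ (hEsub hz).1, hm₂ _ (hEsub hz).2⟩) hε
    have hsub : ∀ i, Es i ⊆ E := fun i => hEs.2.1 ▸ subset_iUnion Es i
    have htail : ∀ {a x : lp (fun _ : ℕ => ℝ) p} {r : ℝ}, x ∈ closedBall a r →
        ‖a - lpTruncate p n a‖ ≤ ε → ‖x - lpTruncate p n x‖ ≤ r + ε := by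
      intro a x r hx ha
      rw [mem_closedBall, dist_eq_norm] at hx
      calc ‖x - lpTruncate p n x‖
          = ‖((x - a) - lpTruncate p n (x - a)) + (a - lpTruncate p n a)‖ := by
            rw [map_sub]; congr 1; abel
        _ ≤ _ := norm_add_le _ _
        _ ≤ r + ε := add_le_add ((norm_sub_lpTruncate_le hp n _).trans hx) ha
    refine ⟨N, Es, hEs, fun i => pairDiam_lt_mul_pairGap_pairRect hp (hEs.1 i)
      (n := n) (by linarith) (le_trans (by positivity) hgap.le) hε hεc hcd hlt
      (fun z hz => pairGap_le (hsub i hz)) (fun z hz => ?_) (hclose i)⟩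
    calc ‖(z.1 - z.2) - lpTruncate p n (z.1 - z.2)‖
        = ‖(z.1 - lpTruncate p n z.1) - (z.2 - lpTruncate p n z.2)‖ := by
          rw [map_sub]; congr 1; abel
      _ ≤ _ := norm_sub_le _ _
      _ ≤ (r₁ + ε) + (r₂ + ε) :=
        add_le_add (htail (hEsub (hsub i hz)).1 hn₁) (htail (hEsub (hsub i hz)).2 hn₂)
      _ ≤ 2 * R' := by linarith [le_max_left r₁ r₂, le_max_right r₁ r₂]
  · rw [one_div, Real.lt_rpow_inv_iff_of_pos (by norm_num) (by positivity) hq0]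
    linarith
  · rw [dist_eq_norm]
    exact ⟨abs_norm_sub_norm_le x y, (norm_sub_le x y).trans
      (by linarith [le_max_left ‖x‖ ‖y‖, le_max_right ‖x‖ ‖y‖])⟩
end

section
/- Let (M,d) be a separable metric space. Then there exists a map f : M → c₀⁺ such that d(x,y) < ‖f(x) − f(y)‖ < 3·d(x,y) whenever x ≠ y. -/
open Metric Set ZeroAtInfty

/-- A countable family of nonnegative functions on `M`, each with Lipschitz constant less than
`lam`, tending to zero pointwise and separating points strictly, gives a strict embedding
into `c₀⁺`. -/
theorem exists_strictEmbedding_of_family {M ι : Type*} [MetricSpace M] [Denumerable ι]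
    {lam : ℝ} (g : ι → M → ℝ) (K : ι → ℝ) (hK : ∀ i, K i < lam) (h0 : ∀ i x, 0 ≤ g i x)
    (hLip : ∀ i x y, |g i x - g i y| ≤ K i * dist x y)
    (hfin : ∀ x, ∀ e : ℝ, 0 < e → {i | e ≤ g i x}.Finite)
    (hsep : ∀ x y, x ≠ y → ∃ i, dist x y < |g i x - g i y|) :
    ∃ f : M → C₀(ℕ, ℝ), (∀ (x : M) (n : ℕ), 0 ≤ f x n) ∧
      ∀ x y : M, x ≠ y → dist x y < ‖f x - f y‖ ∧ ‖f x - f y‖ < lam * dist x y := by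
  let e : ι ≃ ℕ := Denumerable.eqv ι
  have htend : ∀ x, Filter.Tendsto (fun n => g (e.symm n) x) (Filter.cocompact ℕ) (nhds 0) := by
    intro x
    rw [Filter.cocompact_eq_cofinite, Metric.tendsto_nhds]
    intro r hr
    rw [Filter.eventually_cofinite]
    refine ((hfin x r hr).image e).subset ?_
    intro n hn
    refine ⟨e.symm n, ?_, by simp⟩
    simpa [Real.dist_eq, abs_of_nonneg (h0 _ _)] using hn
  let f : M → C₀(ℕ, ℝ) := fun x =>
    { toFun := fun n => g (e.symm n) x
      continuous_toFun := continuous_of_discreteTopology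
      zero_at_infty' := htend x }
  have hf : ∀ x n, f x n = g (e.symm n) x := fun _ _ => rfl
  refine ⟨f, fun x n => h0 _ _, fun x y hxy => ?_⟩
  have hd : 0 < dist x y := dist_pos.2 hxy
  set h : C₀(ℕ, ℝ) := f x - f y with hh
  have hhn : ∀ n, h n = g (e.symm n) x - g (e.symm n) y := fun n => by
    rw [hh, ZeroAtInftyContinuousMap.sub_apply, hf, hf]
  have hle : ∀ n, |h n| ≤ ‖h‖ := fun n => by
    rw [← ZeroAtInftyContinuousMap.norm_toBCF_eq_norm]
    exact h.toBCF.norm_coe_le_norm n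
  obtain ⟨i, hi⟩ := hsep x y hxy
  have hi' : dist x y < |h (e i)| := by simpa [hhn] using hi
  have hfin' : {n | dist x y ≤ |h n|}.Finite := by
    have := h.zero_at_infty'
    rw [Filter.cocompact_eq_cofinite, Metric.tendsto_nhds] at this
    have := Filter.eventually_cofinite.1 (this _ hd)
    simpa [Real.dist_eq] using this
  obtain ⟨n, hn, hmax⟩ := Set.exists_max_image _ (fun n => |h n|) hfin' ⟨e i, hi'.le⟩
  refine ⟨hi'.trans_le (hle _), ?_⟩
  have hbound : ‖h‖ ≤ |h n| := by
    rw [← ZeroAtInftyContinuousMap.norm_toBCF_eq_norm]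
    refine (BoundedContinuousFunction.norm_le (abs_nonneg _)).2 fun m => ?_
    by_cases hm : dist x y ≤ |h m|
    · exact hmax m hm
    · exact (not_le.1 hm).le.trans hn
  calc ‖h‖ ≤ |h n| := hbound
    _ ≤ K (e.symm n) * dist x y := by rw [hhn]; exact hLip _ _ _
    _ < lam * dist x y := by gcongr; exact hK _

theorem finite_setOf_zpow_mem_Icc {b : ℝ} (hb : 1 < b) {c C : ℝ} (hc : 0 < c) :
    {m : ℤ | c ≤ b ^ m ∧ b ^ m ≤ C}.Finite := by
  obtain ⟨p, hp⟩ := pow_unbounded_of_one_lt C hb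
  obtain ⟨q, hq⟩ := pow_unbounded_of_one_lt c⁻¹ hb
  refine (Set.finite_Icc (-(q : ℤ)) p).subset fun m hm => ⟨?_, ?_⟩
  · by_contra! hlt
    have h1 : b ^ m < b ^ (-(q : ℤ)) := zpow_lt_zpow_right₀ hb hlt
    rw [zpow_neg, zpow_natCast] at h1
    have h2 : (b ^ q)⁻¹ < c := inv_lt_of_inv_lt₀ hc hq
    linarith [hm.1]
  · by_contra! hlt
    have h1 : b ^ (p : ℤ) < b ^ m := zpow_lt_zpow_right₀ hb hlt
    rw [zpow_natCast] at h1
    linarith [hm.2]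

/-- The truncated cone of height `ρ` and slope `K` over the set `U`; zero if `U` is empty. -/
noncomputable def coneOver {M : Type*} [MetricSpace M] (ρ K : ℝ) (U : Set M) (z : M) : ℝ :=
  open Classical in if U.Nonempty then max 0 (ρ - K * infDist z U) else 0

section coneOver

variable {M : Type*} [MetricSpace M] {ρ K : ℝ} {U : Set M}

theorem coneOver_nonneg (z : M) : 0 ≤ coneOver ρ K U z := by
  unfold coneOver; split_ifs <;> simp

theorem coneOver_le (hρ : 0 ≤ ρ) (hK : 0 ≤ K) (z : M) : coneOver ρ K U z ≤ ρ := by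
  unfold coneOver; split_ifs
  · exact max_le hρ (by linarith [mul_nonneg hK (infDist_nonneg (x := z) (s := U))])
  · exact hρ

theorem coneOver_le_add (hK : 0 ≤ K) (x y : M) :
    coneOver ρ K U x ≤ coneOver ρ K U y + K * dist x y := by
  have hd : 0 ≤ K * dist x y := mul_nonneg hK dist_nonneg
  unfold coneOver; split_ifs
  · refine max_le (add_nonneg (le_max_left _ _) hd) ?_
    have h1 : infDist y U ≤ infDist x U + dist y x := infDist_le_infDist_add_dist
    have h2 := mul_le_mul_of_nonneg_left h1 hK
    rw [dist_comm y x] at h2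
    linarith [le_max_right 0 (ρ - K * infDist y U)]
  · linarith

theorem abs_coneOver_sub_le (hK : 0 ≤ K) (x y : M) :
    |coneOver ρ K U x - coneOver ρ K U y| ≤ K * dist x y := by
  rw [abs_sub_le_iff]
  have h1 := coneOver_le_add (ρ := ρ) (U := U) hK x y
  have h2 := coneOver_le_add (ρ := ρ) (U := U) hK y x
  rw [dist_comm y x] at h2
  constructor <;> linarith

theorem coneOver_of_mem (hρ : 0 ≤ ρ) {z : M} (hz : z ∈ U) : coneOver ρ K U z = ρ := by
  have : U.Nonempty := ⟨z, hz⟩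
  simp [coneOver, this, infDist_zero_of_mem hz, hρ]

theorem coneOver_le_of_forall_dist {c s : ℝ} (hK : 0 ≤ K) (hc : 0 ≤ c) (hs : ρ - K * s ≤ c)
    {z : M} (h : ∀ u ∈ U, s ≤ dist z u) : coneOver ρ K U z ≤ c := by
  unfold coneOver; split_ifs with hU
  · have := mul_le_mul_of_nonneg_left ((le_infDist hU).2 fun {y} => h y) hK
    exact max_le hc (by linarith)
  · exact hc

end coneOver

/-- Points `x` which have a partner `y` at distance roughly `t`, which are close to `a i` and
far from every `a j` with `j < k`, relative to that distance. -/
def pairLevelSet {M : Type*} [MetricSpace M] (a : ℕ → M) (η θ t : ℝ) (k i : ℕ) : Set M :=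
  {x | ∃ y, t ≤ dist x y ∧ dist x y < (1 + η / 4) * t ∧
    3 * dist x (a i) ≤ (1 - η) * dist x y ∧ ∀ j < k, (1 - θ) * dist x y ≤ 3 * dist x (a j)}

section pairLevelSet

variable {M : Type*} [MetricSpace M] {a : ℕ → M} {η θ t : ℝ} {k i : ℕ}

theorem dist_le_of_mem_pairLevelSet (h0 : 0 < η) (h1 : η ≤ 1) (ht : 0 ≤ t) {u : M}
    (hu : u ∈ pairLevelSet a η θ t k i) : dist u (a i) ≤ (1 - η / 2) * t / 3 := by
  obtain ⟨y, -, hy2, hy3, -⟩ := hu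
  have h2 : (1 - η) * dist u y ≤ (1 - η) * ((1 + η / 4) * t) :=
    mul_le_mul_of_nonneg_left hy2.le (by linarith)
  have h3 : (1 - η) * ((1 + η / 4) * t) ≤ (1 - η / 2) * t := by
    nlinarith [mul_nonneg h0.le ht, mul_nonneg (sq_nonneg η) ht]
  linarith

theorem coneOver_pairLevelSet_eq_zero (h0 : 0 < η) (h1 : η ≤ 1) (ht : 0 ≤ t) {x y : M}
    (hx : x ∈ pairLevelSet a η θ t k i) (hxy : t ≤ dist x y) :
    coneOver ((1 + η / 4) * t) (3 * (1 - η / 4)) (pairLevelSet a η θ t k i) y = 0 := by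
  refine le_antisymm (coneOver_le_of_forall_dist (s := (1 + η) * t / 3) (by linarith) le_rfl
    ?_ fun u hu => ?_) (coneOver_nonneg _)
  · nlinarith [mul_nonneg h0.le ht, mul_nonneg (mul_nonneg h0.le (sub_nonneg.2 h1)) ht]
  · have hx' := dist_le_of_mem_pairLevelSet h0 h1 ht hx
    have hu' := dist_le_of_mem_pairLevelSet h0 h1 ht hu
    have h2 := dist_triangle4 x (a i) u y
    rw [dist_comm (a i) u, dist_comm u y] at h2
    linarith

theorem coneOver_pairLevelSet_apply_le (h0 : 0 < η) (h1 : η ≤ 1) (hθ : 0 ≤ θ) (hθ1 : θ ≤ 1)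
    (ht : 0 ≤ t) {j : ℕ} (hj : j < k) :
    coneOver ((1 + η / 4) * t) (3 * (1 - η / 4)) (pairLevelSet a η θ t k i) (a j) ≤
      (η + θ) * t := by
  refine coneOver_le_of_forall_dist (s := (1 - θ) * t / 3) (by linarith) (by positivity)
    ?_ fun u hu => ?_
  · nlinarith [mul_nonneg h0.le ht, mul_nonneg (mul_nonneg h0.le hθ) ht]
  · obtain ⟨y, hy1, -, -, hy4⟩ := hu
    have h2 := hy4 j hj
    have h3 : (1 - θ) * t ≤ (1 - θ) * dist u y :=
      mul_le_mul_of_nonneg_left hy1 (by linarith)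
    rw [dist_comm (a j) u]
    linarith

end pairLevelSet

/-- A bound for the scales of pairs whose points are resolved by `a 0, …, a k`. -/
noncomputable def scaleBound {M : Type*} [MetricSpace M] (a : ℕ → M) (k : ℕ) : ℝ :=
  1 + 3 * ∑ i ∈ Finset.range (k + 1), ∑ j ∈ Finset.range (k + 1), dist (a i) (a j)

/-- The relative slack `1 / (k * scaleBound a k)`. -/
noncomputable def slack {M : Type*} [MetricSpace M] (a : ℕ → M) (k : ℕ) : ℝ :=
  1 / (k * scaleBound a k)

section scale

variable {M : Type*} [MetricSpace M] (a : ℕ → M)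

theorem one_le_scaleBound (k : ℕ) : 1 ≤ scaleBound a k := by
  have : 0 ≤ ∑ i ∈ Finset.range (k + 1), ∑ j ∈ Finset.range (k + 1), dist (a i) (a j) := by
    positivity
  unfold scaleBound
  linarith

theorem three_mul_dist_le_scaleBound {k i j : ℕ} (hi : i ≤ k) (hj : j ≤ k) :
    3 * dist (a i) (a j) ≤ scaleBound a k := by
  have h1 : dist (a i) (a j) ≤ ∑ j ∈ Finset.range (k + 1), dist (a i) (a j) :=
    Finset.single_le_sum (f := fun j => dist (a i) (a j)) (fun _ _ => dist_nonneg)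
      (Finset.mem_range.2 (by omega))
  have h2 : ∑ j ∈ Finset.range (k + 1), dist (a i) (a j) ≤
      ∑ i ∈ Finset.range (k + 1), ∑ j ∈ Finset.range (k + 1), dist (a i) (a j) :=
    Finset.single_le_sum (f := fun i => ∑ j ∈ Finset.range (k + 1), dist (a i) (a j))
      (fun _ _ => by positivity) (Finset.mem_range.2 (by omega))
  unfold scaleBound
  linarith

theorem scaleBound_mono (k : ℕ) : scaleBound a k ≤ scaleBound a (k + 1) := by
  have hsub : Finset.range (k + 1) ⊆ Finset.range (k + 1 + 1) :=
    Finset.range_subset_range.2 (by omega)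
  have h : ∑ i ∈ Finset.range (k + 1), ∑ j ∈ Finset.range (k + 1), dist (a i) (a j) ≤
      ∑ i ∈ Finset.range (k + 1 + 1), ∑ j ∈ Finset.range (k + 1 + 1), dist (a i) (a j) :=
    (Finset.sum_le_sum fun i _ =>
      Finset.sum_le_sum_of_subset_of_nonneg hsub fun _ _ _ => dist_nonneg).trans
      (Finset.sum_le_sum_of_subset_of_nonneg hsub fun _ _ _ => by positivity)
  unfold scaleBound
  linarith

theorem slack_nonneg (k : ℕ) : 0 ≤ slack a k := by
  have := one_le_scaleBound a k
  unfold slack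
  positivity

theorem slack_mul_scaleBound (k : ℕ) : slack a k * scaleBound a k = 1 / k := by
  have := one_le_scaleBound a k
  unfold slack
  rcases eq_or_ne k 0 with rfl | hk
  · simp
  · field_simp

theorem slack_le (k : ℕ) : slack a k ≤ 1 / k := by
  rw [← slack_mul_scaleBound a k]
  exact le_mul_of_one_le_right (slack_nonneg a k) (one_le_scaleBound a k)

theorem slack_le_one (k : ℕ) : slack a k ≤ 1 := by
  refine (slack_le a k).trans ?_
  rcases Nat.eq_zero_or_pos k with rfl | hk
  · simp
  · exact (div_le_one (by positivity)).2 (by exact_mod_cast hk)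

theorem slack_succ_pos (k : ℕ) : 0 < slack a (k + 1) := by
  have := one_le_scaleBound a (k + 1)
  unfold slack
  positivity

theorem slack_succ_mul_scaleBound_le (k : ℕ) :
    slack a (k + 1) * scaleBound a k ≤ 1 / ((k : ℝ) + 1) := by
  refine (mul_le_mul_of_nonneg_left (scaleBound_mono a k) (slack_nonneg a _)).trans ?_
  rw [slack_mul_scaleBound]
  push_cast
  exact le_rfl

end scale

/-- The ratio of the geometric grid of scales used at stage `k`. -/
noncomputable def gridRatio {M : Type*} [MetricSpace M] (a : ℕ → M) (k : ℕ) : ℝ :=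
  1 + slack a (k + 1) / 4

/-- The coordinate functions of the embedding into `c₀⁺`, indexed by a stage `k`, a centre `a i`
and the exponent `m` of a scale. -/
noncomputable def coneCoord {M : Type*} [MetricSpace M] (a : ℕ → M) (p : ℕ × ℕ × ℤ) (z : M) : ℝ :=
  open Classical in
  if p.2.1 ≤ p.1 ∧ gridRatio a p.1 ^ p.2.2 ≤ scaleBound a p.1 then
    coneOver (gridRatio a p.1 * gridRatio a p.1 ^ p.2.2) (3 * (1 - slack a (p.1 + 1) / 4))
      (pairLevelSet a (slack a (p.1 + 1)) (slack a p.1) (gridRatio a p.1 ^ p.2.2) p.1 p.2.1) z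
  else 0

section coneCoord

variable {M : Type*} [MetricSpace M] (a : ℕ → M)

theorem one_lt_gridRatio (k : ℕ) : 1 < gridRatio a k := by
  have := slack_succ_pos a k
  unfold gridRatio
  linarith

theorem coneCoord_nonneg (p : ℕ × ℕ × ℤ) (z : M) : 0 ≤ coneCoord a p z := by
  unfold coneCoord
  split_ifs
  · exact coneOver_nonneg z
  · exact le_rfl

theorem abs_coneCoord_sub_le (p : ℕ × ℕ × ℤ) (x y : M) :
    |coneCoord a p x - coneCoord a p y| ≤ 3 * (1 - slack a (p.1 + 1) / 4) * dist x y := by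
  have hK : 0 ≤ 3 * (1 - slack a (p.1 + 1) / 4) := by linarith [slack_le_one a (p.1 + 1)]
  unfold coneCoord
  split_ifs
  · exact abs_coneOver_sub_le hK x y
  · simpa using mul_nonneg hK dist_nonneg

theorem coneCoord_apply_le {p : ℕ × ℕ × ℤ} {j : ℕ} (hj : j < p.1) :
    coneCoord a p (a j) ≤ 2 / p.1 := by
  have hp : (0 : ℝ) < p.1 := by exact_mod_cast (Nat.zero_le j).trans_lt hj
  unfold coneCoord
  split_ifs with h
  · have ht : 0 < gridRatio a p.1 ^ p.2.2 := zpow_pos (by linarith [one_lt_gridRatio a p.1]) _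
    refine (coneOver_pairLevelSet_apply_le (slack_succ_pos a _) (slack_le_one a _)
      (slack_nonneg a _) (slack_le_one a _) ht.le hj).trans ?_
    have h1 := slack_succ_mul_scaleBound_le a p.1
    have h2 := slack_mul_scaleBound a p.1
    have h3 : 1 / ((p.1 : ℝ) + 1) ≤ 1 / p.1 := one_div_le_one_div_of_le hp (by linarith)
    calc (slack a (p.1 + 1) + slack a p.1) * gridRatio a p.1 ^ p.2.2
        ≤ (slack a (p.1 + 1) + slack a p.1) * scaleBound a p.1 :=
          mul_le_mul_of_nonneg_left h.2 (add_nonneg (slack_nonneg a _) (slack_nonneg a _))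
      _ ≤ 1 / p.1 + 1 / p.1 := by rw [add_mul]; linarith
      _ = 2 / p.1 := by ring
  · positivity

theorem finite_setOf_le_coneCoord (ha : DenseRange a) (z : M) {e : ℝ} (he : 0 < e) :
    {p | e ≤ coneCoord a p z}.Finite := by
  obtain ⟨j, hj⟩ := ha.exists_dist_lt z (show 0 < e / 6 by positivity)
  obtain ⟨n, hn⟩ := exists_nat_gt (4 / e)
  have key : ∀ p : ℕ × ℕ × ℤ, e ≤ coneCoord a p z → p.1 < max (j + 1) (n + 1) ∧ p.2.1 ≤ p.1 ∧
      e / 2 ≤ gridRatio a p.1 ^ p.2.2 ∧ gridRatio a p.1 ^ p.2.2 ≤ scaleBound a p.1 := by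
    intro p hp
    have h1 := slack_le_one a (p.1 + 1)
    have h2 := slack_succ_pos a p.1
    have ht : 0 < gridRatio a p.1 ^ p.2.2 := zpow_pos (by linarith [one_lt_gridRatio a p.1]) _
    have hcond : p.2.1 ≤ p.1 ∧ gridRatio a p.1 ^ p.2.2 ≤ scaleBound a p.1 := by
      by_contra hcond
      rw [coneCoord, if_neg hcond] at hp
      linarith
    refine ⟨?_, hcond.1, ?_, hcond.2⟩
    · by_contra! hlt
      have hjp : j < p.1 := by omega
      have hnp : (n : ℝ) < p.1 := by exact_mod_cast (show n < p.1 by omega)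
      have h3 := coneCoord_apply_le a hjp
      have h4 := (abs_sub_le_iff.1 (abs_coneCoord_sub_le a p z (a j))).1
      have h5 : 3 * (1 - slack a (p.1 + 1) / 4) * dist z (a j) ≤ 3 * dist z (a j) :=
        mul_le_mul_of_nonneg_right (by linarith) dist_nonneg
      have hp0 : (0 : ℝ) < p.1 := (Nat.cast_nonneg n).trans_lt hnp
      have h6 : 2 / (p.1 : ℝ) < e / 2 := by
        have h7 : 4 / e < p.1 := hn.trans hnp
        rw [div_lt_iff₀ he] at h7
        rw [div_lt_iff₀ hp0]
        linarith
      linarith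
    · rw [coneCoord, if_pos hcond] at hp
      have h3 := hp.trans (coneOver_le (mul_nonneg (by linarith [one_lt_gridRatio a p.1]) ht.le)
        (by linarith) z)
      have h4 : gridRatio a p.1 ≤ 2 := by unfold gridRatio; linarith
      have h5 := mul_le_mul_of_nonneg_right h4 ht.le
      linarith
  refine Set.Finite.subset (Set.Finite.biUnion (Set.finite_lt_nat (max (j + 1) (n + 1)))
    fun k _ => Set.Finite.biUnion (Set.finite_le_nat k) fun i _ =>
      (finite_setOf_zpow_mem_Icc (one_lt_gridRatio a k) (C := scaleBound a k)
        (half_pos he)).image fun m => ((k, i, m) : ℕ × ℕ × ℤ)) ?_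
  rintro ⟨k, i, m⟩ hp
  obtain ⟨h1, h2, h3⟩ := key _ hp
  simp only [Set.mem_iUnion]
  exact ⟨k, h1, i, h2, m, h3, rfl⟩

/-- The point `x` is resolved at stage `k`, relative to its distance to `y`. -/
def IsResolved (x y : M) (k : ℕ) : Prop :=
  ∃ i ≤ k, 3 * dist x (a i) ≤ (1 - slack a (k + 1)) * dist x y

theorem exists_isResolved (ha : DenseRange a) {x y : M} (hxy : x ≠ y) :
    ∃ k, IsResolved a x y k := by
  have hd : 0 < dist x y := dist_pos.2 hxy
  obtain ⟨i, hi⟩ := ha.exists_dist_lt x (show 0 < dist x y / 6 by positivity)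
  refine ⟨i + 1, i, by omega, ?_⟩
  have h1 : slack a (i + 1 + 1) ≤ 1 / 2 := by
    refine (slack_le a _).trans (one_div_le_one_div_of_le (by norm_num) ?_)
    push_cast
    linarith [(Nat.cast_nonneg i : (0 : ℝ) ≤ i)]
  nlinarith

theorem exists_lt_coneCoord_of_isResolved {x y : M} (hxy : x ≠ y) {k l : ℕ}
    (hx : IsResolved a x y k) (hmin : ∀ k' < k, ¬ IsResolved a x y k')
    (hy : IsResolved a y x l) (hl : l ≤ k) :
    ∃ p, dist x y < |coneCoord a p x - coneCoord a p y| := by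
  have hd : 0 < dist x y := dist_pos.2 hxy
  obtain ⟨i, hik, hi⟩ := hx
  obtain ⟨j, hjl, hj⟩ := hy
  have hη := slack_succ_pos a k
  have hη1 := slack_le_one a (k + 1)
  obtain ⟨m, hm1, hm2⟩ := exists_mem_Ico_zpow hd (one_lt_gridRatio a k)
  have hg : 0 < gridRatio a k := by linarith [one_lt_gridRatio a k]
  have ht : 0 < gridRatio a k ^ m := zpow_pos hg _
  rw [zpow_add_one₀ hg.ne', mul_comm] at hm2
  have hbound : dist x y ≤ scaleBound a k := by
    have h1 := three_mul_dist_le_scaleBound a hik (hjl.trans hl)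
    have h2 := dist_triangle4 x (a i) (a j) y
    have h3 := mul_nonneg hη.le hd.le
    have h4 := mul_nonneg (slack_nonneg a (l + 1)) hd.le
    rw [dist_comm y x] at hj
    rw [dist_comm (a j) y] at h2
    linarith
  have hmem : x ∈ pairLevelSet a (slack a (k + 1)) (slack a k) (gridRatio a k ^ m) k i := by
    refine ⟨y, hm1, hm2, hi, fun j hj => ?_⟩
    obtain ⟨k', rfl⟩ : ∃ k', k = k' + 1 := ⟨k - 1, by omega⟩
    by_contra! hlt
    exact hmin k' (by omega) ⟨j, by omega, hlt.le⟩
  have hcond : i ≤ k ∧ gridRatio a k ^ m ≤ scaleBound a k := ⟨hik, hm1.trans hbound⟩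
  refine ⟨(k, i, m), ?_⟩
  have hx0 : coneCoord a (k, i, m) x = gridRatio a k * gridRatio a k ^ m := by
    rw [coneCoord, if_pos hcond]
    exact coneOver_of_mem (by positivity) hmem
  have hy0 : coneCoord a (k, i, m) y = 0 := by
    rw [coneCoord, if_pos hcond]
    exact coneOver_pairLevelSet_eq_zero hη hη1 ht.le hmem hm1
  rw [hx0, hy0, sub_zero]
  exact hm2.trans_le (le_abs_self _)

theorem exists_lt_coneCoord (ha : DenseRange a) {x y : M} (hxy : x ≠ y) :
    ∃ p, dist x y < |coneCoord a p x - coneCoord a p y| := by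
  classical
  have hx := exists_isResolved a ha hxy
  have hy := exists_isResolved a ha hxy.symm
  rcases le_total (Nat.find hy) (Nat.find hx) with h | h
  · exact exists_lt_coneCoord_of_isResolved a hxy (Nat.find_spec hx)
      (fun _ => Nat.find_min hx) (Nat.find_spec hy) h
  · obtain ⟨p, hp⟩ := exists_lt_coneCoord_of_isResolved a hxy.symm (Nat.find_spec hy)
      (fun _ => Nat.find_min hy) (Nat.find_spec hx) h
    exact ⟨p, by rwa [dist_comm, abs_sub_comm]⟩

end coneCoord

/-- Corollary 6.10: every separable metric space admits `f : M → c₀⁺` with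
`d(x,y) < ‖f(x) - f(y)‖ < 3·d(x,y)` for `x ≠ y`. -/
theorem stmt19 {M : Type*} [MetricSpace M] [TopologicalSpace.SeparableSpace M] :
    ∃ f : M → C₀(ℕ, ℝ), (∀ (x : M) (n : ℕ), 0 ≤ f x n) ∧
      ∀ x y : M, x ≠ y → dist x y < ‖f x - f y‖ ∧ ‖f x - f y‖ < 3 * dist x y := by
  rcases isEmpty_or_nonempty M with hM | hM
  · exact ⟨fun _ => 0, fun x => isEmptyElim x, fun x => isEmptyElim x⟩
  · have ha := TopologicalSpace.denseRange_denseSeq M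
    refine exists_strictEmbedding_of_family (coneCoord (TopologicalSpace.denseSeq M))
      (fun p => 3 * (1 - slack (TopologicalSpace.denseSeq M) (p.1 + 1) / 4)) (fun p => ?_)
      (coneCoord_nonneg _) (abs_coneCoord_sub_le _)
      (fun z _ he => finite_setOf_le_coneCoord _ ha z he)
      fun _ _ hxy => exists_lt_coneCoord _ ha hxy
    linarith [slack_succ_pos (TopologicalSpace.denseSeq M) p.1]
end
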